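/- arXiv:0805.1211 — 4 statements merged into one kernel-verified Lean document; each statement's English description precedes it below -/
import Mathlib

section
/- Let n ≥ 2 and let I be an ideal of the polynomial ring ℂ[x₁,…,xₙ] (multivariate polynomials over ℂ in n variables) such that the Krull dimension of the quotient ring ℂ[x₁,…,xₙ]/I is at most n − 2. Let V = {x ∈ ℂⁿ : p(x) = 0 for all p ∈ I} be the zero locus of I. Then the complement ℂⁿ \ V, equipped with the subspace topology from the Euclidean topology on ℂⁿ, is simply connected. -/
namespace SmallcodimNN
section equivT
open Polynomial MvPolynomial Ideal Nat RingHom List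

variable {k : Type*} [Field k] {n : ℕ} (f : MvPolynomial (Fin (n + 1)) k)
variable (v w : Fin (n + 1) →₀ ℕ)

variable {f v} in
lemma lt_up (vlt : ∀ i, v i < (2 + f.totalDegree)) : ∀ l ∈ ofFn v, l < (2 + f.totalDegree) := by
  grind

/-- We construct an algebra map `T1 f c` which maps `X_i` into `X_i + c • X_0 ^ r_i` when `i ≠ 0`
and `X_0` to `X_0`. -/
noncomputable abbrev T1 (c : k) :
    MvPolynomial (Fin (n + 1)) k →ₐ[k] MvPolynomial (Fin (n + 1)) k :=
  aeval fun i ↦ if i = 0 then X 0 else X i + c • X 0 ^ ((2 + f.totalDegree) ^ (i : ℕ))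

lemma t1_comp_t1_neg (c : k) : (T1 f c).comp (T1 f (-c)) = AlgHom.id _ _ := by
  rw [comp_aeval, ← MvPolynomial.aeval_X_left]
  ext i v
  cases i using Fin.cases <;> simp

/-- `T1 f 1` leads to an algebra equiv `T f`. -/
noncomputable abbrev T := AlgEquiv.ofAlgHom (T1 f 1) (T1 f (-1))
  (t1_comp_t1_neg f 1) (by simpa using t1_comp_t1_neg f (-1))

lemma sum_r_mul_ne (vlt : ∀ i, v i < (2 + f.totalDegree)) (wlt : ∀ i, w i < (2 + f.totalDegree)) (ne : v ≠ w) :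
    ∑ x : Fin (n + 1), (2 + f.totalDegree) ^ (x : ℕ) * v x ≠ ∑ x : Fin (n + 1), (2 + f.totalDegree) ^ (x : ℕ) * w x := by
  intro h
  refine ne <| Finsupp.ext <| congrFun <| ofFn_inj.mp ?_
  apply ofDigits_inj_of_len_eq (Nat.lt_add_right f.totalDegree one_lt_two)
    (by simp) (lt_up vlt) (lt_up wlt)
  simpa only [ofDigits_eq_sum_mapIdx, mapIdx_eq_ofFn, get_ofFn, length_ofFn,
    Fin.val_cast, mul_comm, sum_ofFn] using! h

lemma degreeOf_zero_t {a : k} (ha : a ≠ 0) : ((T f) (monomial v a)).degreeOf 0 =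
    ∑ i : Fin (n + 1), ((2 + f.totalDegree) ^ (i : ℕ)) * v i := by
  rw [← natDegree_finSuccEquiv, monomial_eq, Finsupp.prod_pow v fun a ↦ X a]
  simp only [Fin.prod_univ_succ, Fin.sum_univ_succ, map_mul, map_prod, map_pow,
    AlgEquiv.ofAlgHom_apply, MvPolynomial.aeval_C, MvPolynomial.aeval_X, if_pos, Fin.succ_ne_zero,
    ite_false, one_smul, map_add, finSuccEquiv_X_zero, finSuccEquiv_X_succ, algebraMap_eq]
  have h (i : Fin n) :
      (Polynomial.C (X (R := k) i) + Polynomial.X ^ ((2 + f.totalDegree) ^ (i.succ : ℕ))) ^ v i.succ ≠ 0 :=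
    pow_ne_zero (v i.succ) (leadingCoeff_ne_zero.mp <| by simp [add_comm, leadingCoeff_X_pow_add_C])
  rw [natDegree_mul (by simp [ha]) (mul_ne_zero (by simp) (Finset.prod_ne_zero_iff.mpr
    (fun i _ ↦ h i))), natDegree_mul (by simp) (Finset.prod_ne_zero_iff.mpr (fun i _ ↦ h i)),
    natDegree_prod _ _ (fun i _ ↦ h i), natDegree_finSuccEquiv, degreeOf_C]
  simpa only [natDegree_pow, zero_add, natDegree_X, mul_one, Fin.val_zero, pow_zero, one_mul,
    add_right_inj] using Finset.sum_congr rfl (fun i _ ↦ by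
    rw [add_comm (Polynomial.C _), natDegree_X_pow_add_C, mul_comm])

/-- `T` maps different monomials of `f` to polynomials with different degrees in `X_0`. -/
lemma degreeOf_t_ne_of_ne (hv : v ∈ f.support) (hw : w ∈ f.support) (ne : v ≠ w) :
    (T f <| monomial v <| coeff v f).degreeOf 0 ≠
    (T f <| monomial w <| coeff w f).degreeOf 0 := by
  rw [degreeOf_zero_t _ _ <| mem_support_iff.mp hv, degreeOf_zero_t _ _ <| mem_support_iff.mp hw]
  refine sum_r_mul_ne f v w (fun i ↦ ?_) (fun i ↦ ?_) ne <;>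
  exact lt_of_le_of_lt ((monomial_le_degreeOf i ‹_›).trans (degreeOf_le_totalDegree f i))
    (by lia)

lemma leadingCoeff_finSuccEquiv_t :
    (finSuccEquiv k n ((T f) ((monomial v) (coeff v f)))).leadingCoeff =
    algebraMap k _ (coeff v f) := by
  rw [monomial_eq, Finsupp.prod_fintype]
  · simp only [map_mul, map_prod, leadingCoeff_mul, leadingCoeff_prod]
    rw [AlgEquiv.ofAlgHom_apply, algHom_C, algebraMap_eq, finSuccEquiv_apply,
      eval₂Hom_C, coe_comp]
    simp only [AlgEquiv.ofAlgHom_apply, Function.comp_apply, leadingCoeff_C, map_pow,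
      leadingCoeff_pow, algebraMap_eq]
    have : ∀ j, ((finSuccEquiv k n) ((T1 f) 1 (X j))).leadingCoeff = 1 := fun j ↦ by
      by_cases h : j = 0
      · simp [h, finSuccEquiv_apply]
      · simp only [aeval_eq_bind₁, bind₁_X_right, if_neg h, one_smul, map_add, map_pow]
        obtain ⟨i, rfl⟩ := Fin.exists_succ_eq.mpr h
        simp [finSuccEquiv_X_succ, finSuccEquiv_X_zero, add_comm]
    simp only [this, one_pow, Finset.prod_const_one, mul_one]
  exact fun i ↦ pow_zero _

/-- `T` maps `f` into some polynomial in `X_0` such that the leading coefficient is invertible. -/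
lemma T_leadingcoeff_isUnit (fne : f ≠ 0) :
    IsUnit (finSuccEquiv k n (T f f)).leadingCoeff := by
  obtain ⟨v, vin, vs⟩ := Finset.exists_max_image f.support
    (fun v ↦ (T f ((monomial v) (coeff v f))).degreeOf 0) (support_nonempty.mpr fne)
  set h := fun w ↦ (MvPolynomial.monomial w) (coeff w f)
  simp only [← natDegree_finSuccEquiv] at vs
  replace vs : ∀ x ∈ f.support \ {v}, (finSuccEquiv k n ((T f) (h x))).degree <
      (finSuccEquiv k n ((T f) (h v))).degree := by
    intro x hx
    obtain ⟨h1, h2⟩ := Finset.mem_sdiff.mp hx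
    apply degree_lt_degree <| lt_of_le_of_ne (vs x h1) ?_
    simpa only [natDegree_finSuccEquiv]
      using degreeOf_t_ne_of_ne f _ _ h1 vin <| ne_of_not_mem_cons h2
  have coeff : (finSuccEquiv k n ((T f) (h v + ∑ x ∈ f.support \ {v}, h x))).leadingCoeff =
      (finSuccEquiv k n ((T f) (h v))).leadingCoeff := by
    simp only [map_add, map_sum]
    rw [add_comm]
    apply leadingCoeff_add_of_degree_lt <| (lt_of_le_of_lt <| degree_sum_le _ _) ?_
    have h2 : h v ≠ 0 := by simpa [h] using mem_support_iff.mp vin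
    replace h2 : (finSuccEquiv k n ((T f) (h v))) ≠ 0 := fun eq ↦ h2 <|
      by simpa only [map_eq_zero_iff _ (AlgEquiv.injective _)] using eq
    exact (Finset.sup_lt_iff <| Ne.bot_lt (fun x ↦ h2 <| degree_eq_bot.mp x)).mpr vs
  nth_rw 2 [← f.support_sum_monomial_coeff]
  rw [Finset.sum_eq_add_sum_sdiff_singleton_of_mem vin h]
  rw [leadingCoeff_finSuccEquiv_t] at coeff
  simpa only [coeff, algebraMap_eq] using (mem_support_iff.mp vin).isUnit.map MvPolynomial.C

end equivT
end SmallcodimNN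

section SmallcodimTop
open unitInterval Filter Topology

lemma smallcodim_arc_avoid {m : ℕ} (r : MvPolynomial (Fin m) ℂ) (P : Fin m → Polynomial ℂ)
    (h0 : MvPolynomial.eval (fun i => (P i).eval 0) r ≠ 0)
    (h1 : MvPolynomial.eval (fun i => (P i).eval 1) r ≠ 0) (ε : ℝ) (hε : 0 < ε) :
    ∃ γ : C(I, Fin m → ℂ), (∀ t, MvPolynomial.eval (γ t) r ≠ 0) ∧
      γ 0 = (fun i => (P i).eval 0) ∧ γ 1 = (fun i => (P i).eval 1) ∧
      ∀ t : I, dist (γ t) (fun i => (P i).eval ((t : ℝ) : ℂ)) < ε := by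
  set h : Polynomial ℂ := MvPolynomial.aeval P r with hh
  have heval : ∀ z, h.eval z = MvPolynomial.eval (fun i => (P i).eval z) r := by
    intro z
    have : (Polynomial.aeval z).comp (MvPolynomial.aeval P) =
        (MvPolynomial.aeval (fun i => (P i).eval z) : MvPolynomial (Fin m) ℂ →ₐ[ℂ] ℂ) := by
      ext i; simp
    have := DFunLike.congr_fun this r
    simpa [hh, MvPolynomial.aeval_eq_eval] using this
  have hne : h ≠ 0 := by
    intro h'; apply h0; rw [← heval, h']; simp
  let c : ℝ → I → ℂ := fun δ t => (t : ℝ) + Complex.I * (δ * ((t : ℝ) * (1 - (t : ℝ))))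
  let G : C(ℝ × I, Fin m → ℂ) := ⟨fun p i => (P i).eval (c p.1 p.2), by
    apply continuous_pi; intro i
    exact (P i).continuous.comp (by fun_prop)⟩
  have hG : Continuous G.curry := G.curry.continuous
  have hnear : ∀ᶠ δ in 𝓝 (0 : ℝ), dist (G.curry δ) (G.curry 0) < ε :=
    (Metric.tendsto_nhds.1 (hG.tendsto 0)) ε hε
  let S : Set ℝ := (fun z : ℂ => z.im / (z.re * (1 - z.re))) '' (h.rootSet ℂ)
  have hS : S.Finite := (h.rootSet_finite ℂ).image _
  have hSn : ∀ᶠ δ in 𝓝 (0 : ℝ), δ ∉ S \ {0} :=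
    (hS.subset Set.sdiff_subset).isClosed.isOpen_compl.mem_nhds (by simp)
  obtain ⟨δ, hδ0, hδ1, hδ2⟩ : ∃ δ : ℝ, δ ≠ 0 ∧ δ ∉ S \ {0} ∧ dist (G.curry δ) (G.curry 0) < ε := by
    have h1 : ∀ᶠ δ in 𝓝[≠] (0 : ℝ), δ ∉ S \ {0} ∧ dist (G.curry δ) (G.curry 0) < ε :=
      (hSn.and hnear).filter_mono nhdsWithin_le_nhds
    have h2 : ∀ᶠ δ in 𝓝[≠] (0 : ℝ), δ ≠ 0 := eventually_mem_nhdsWithin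
    exact (h2.and h1).exists
  refine ⟨G.curry δ, ?_, ?_, ?_, ?_⟩
  · intro t ht
    have ht' : h.eval (c δ t) = 0 := by rw [heval]; exact ht
    by_cases t0 : t = 0
    · subst t0; apply h0; rw [← heval]; simpa [c] using ht'
    by_cases t1 : t = 1
    · subst t1; apply h1; rw [← heval]; simpa [c] using ht'
    apply hδ1
    refine ⟨⟨c δ t, ?_, ?_⟩, hδ0⟩
    · rw [Polynomial.mem_rootSet]; exact ⟨hne, by simpa using ht'⟩
    · have hre : (c δ t).re = t := by simp [c]
      have him : (c δ t).im = δ * (t * (1 - t)) := by simp [c]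
      simp only [hre, him]
      have a0 : (t : ℝ) ≠ 0 := fun h => t0 (Subtype.ext h)
      have a1 : 1 - (t : ℝ) ≠ 0 := fun h => t1 (Subtype.ext (by change (t : ℝ) = 1; linarith))
      field_simp
  · ext i; simp [G, c]
  · ext i; simp [G, c]
  · intro t
    have := (ContinuousMap.dist_lt_iff hε).1 hδ2 t
    simpa [G, c] using this

lemma smallcodim_approx {m : ℕ} (r : MvPolynomial (Fin m) ℂ) (γ : C(I, Fin m → ℂ))
    (h0 : MvPolynomial.eval (γ 0) r ≠ 0) (h1 : MvPolynomial.eval (γ 1) r ≠ 0)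
    (ε : ℝ) (hε : 0 < ε) :
    ∃ γ' : C(I, Fin m → ℂ), (∀ t, MvPolynomial.eval (γ' t) r ≠ 0) ∧
      γ' 0 = γ 0 ∧ γ' 1 = γ 1 ∧ ∀ t : I, dist (γ' t) (γ t) < ε := by
  have hB := bernsteinApproximation_uniform γ
  have hB' := (Metric.tendsto_nhds.1 hB) (ε / 2) (by positivity)
  obtain ⟨n, hn, hn0⟩ := (hB'.and (eventually_ne_atTop 0)).exists
  let P : Fin m → Polynomial ℂ := fun i => ∑ k : Fin (n + 1),
    Polynomial.C (γ (bernstein.z k) i) *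
      (Polynomial.C (n.choose k : ℂ) * Polynomial.X ^ (k : ℕ) * (1 - Polynomial.X) ^ (n - k : ℕ))
  have hP : ∀ t : I, (fun i => (P i).eval ((t : ℝ) : ℂ)) = bernsteinApproximation n γ t := by
    intro t; ext i
    rw [bernsteinApproximation.apply]
    simp [P, Polynomial.eval_finsetSum, bernstein_apply, mul_comm]
  have hP0 : (fun i => (P i).eval 0) = γ 0 := by
    have := hP 0
    rw [bernsteinApproximation.apply_zero] at this
    simpa using this
  have hP1 : (fun i => (P i).eval 1) = γ 1 := by
    have := hP 1
    rw [bernsteinApproximation.apply_one hn0] at this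
    simpa using this
  obtain ⟨γ', a, b, c, d⟩ := smallcodim_arc_avoid r P (by rwa [hP0]) (by rwa [hP1]) (ε / 2)
    (by positivity)
  refine ⟨γ', a, b.trans hP0, c.trans hP1, fun t => ?_⟩
  have e1 := d t
  rw [hP] at e1
  have e2 := (ContinuousMap.dist_lt_iff (by positivity)).1 hn t
  calc _ ≤ _ := dist_triangle _ (bernsteinApproximation n γ t) _
    _ < ε := by linarith

lemma smallcodim_dense {m : ℕ} (r : MvPolynomial (Fin m) ℂ) (hr : r ≠ 0) (x : Fin m → ℂ)
    (ε : ℝ) (hε : 0 < ε) : ∃ x', MvPolynomial.eval x' r ≠ 0 ∧ dist x' x < ε := by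
  by_contra! hcon
  apply hr
  apply MvPolynomial.funext_set (fun i => Metric.ball (x i) ε)
  · intro i
    exact infinite_of_mem_nhds (x i) (Metric.ball_mem_nhds _ hε)
  · intro y hy
    by_contra hne
    simp only [map_zero] at hne
    have := hcon y hne
    have h2 : dist y x < ε := (dist_pi_lt_iff hε).2 (fun i => hy i (Set.mem_univ i))
    linarith

lemma smallcodim_conj {Y : Type*} [TopologicalSpace Y] {a b c d : Y} (P : Path a b) (Q : Path b d)
    (Q' : Path a c) (P' : Path c d) (h : (P.trans Q).Homotopic (Q'.trans P'))
    (hab : a = b) (hcd : c = d) (hQ : ∀ t, Q t = Q' t)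
    (hP' : (P'.cast rfl hcd).Homotopic (Path.refl c)) :
    (P.cast rfl hab).Homotopic (Path.refl a) := by
  subst hab hcd
  have hQQ : Q = Q' := by ext t; exact hQ t
  subst hQQ
  simp only [Path.cast_rfl_rfl] at *
  rw [← Path.Homotopic.Quotient.eq] at *
  simp only [Path.Homotopic.Quotient.mk_trans, Path.Homotopic.Quotient.mk_refl] at *
  rw [hP'] at h
  have := congrArg (fun z => Path.Homotopic.Quotient.trans z
    (Path.Homotopic.Quotient.symm (Path.Homotopic.Quotient.mk Q))) h
  simpa using this

lemma smallcodim_simply_of_base {Y : Type*} [TopologicalSpace Y] (x₀ : Y)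
    (hj : ∀ x, Joined x₀ x)
    (h : ∀ γ : Path x₀ x₀, γ.Homotopic (Path.refl x₀)) : SimplyConnectedSpace Y := by
  rw [simply_connected_iff_loops_nullhomotopic]
  refine ⟨⟨⟨x₀⟩, fun x y => (hj x).symm.trans (hj y)⟩, fun x γ => ?_⟩
  obtain ⟨q⟩ := hj x
  have h1 := h ((q.trans γ).trans q.symm)
  rw [← Path.Homotopic.Quotient.eq] at *
  simp only [Path.Homotopic.Quotient.mk_trans, Path.Homotopic.Quotient.mk_refl,
    Path.Homotopic.Quotient.mk_symm] at *
  have h2 := congrArg (fun z => Path.Homotopic.Quotient.trans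
    (Path.Homotopic.Quotient.symm (Path.Homotopic.Quotient.mk q))
    (Path.Homotopic.Quotient.trans z (Path.Homotopic.Quotient.mk q))) h1
  simp only [Path.Homotopic.Quotient.trans_assoc, Path.Homotopic.Quotient.symm_trans,
    Path.Homotopic.Quotient.trans_refl, Path.Homotopic.Quotient.refl_trans] at h2
  rw [← Path.Homotopic.Quotient.trans_assoc] at h2
  simpa using h2

/-- The closed curve `f` lies in `W` and is null-homotopic in `W`. -/
def SmallcodimNullIn {X : Type*} [TopologicalSpace X] (W : Set X) (f : I → X) : Prop :=
  ∃ (hc : Continuous f) (hW : ∀ t, f t ∈ W) (h : f 0 = f 1),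
    Path.Homotopic (Path.mk (X := W) (x := ⟨f 0, hW 0⟩) (y := ⟨f 0, hW 0⟩)
      ⟨fun t => ⟨f t, hW t⟩, by fun_prop⟩ rfl (Subtype.ext h.symm)) (Path.refl _)

lemma smallcodim_null_const {X : Type*} [TopologicalSpace X] (W : Set X) (w : X) (hw : w ∈ W) :
    SmallcodimNullIn W (fun _ => w) :=
  ⟨continuous_const, fun _ => hw, rfl, Path.Homotopic.refl _⟩

lemma smallcodim_null_step {X : Type*} [TopologicalSpace X] (W : Set X) (H : I → I → X)
    (hc : Continuous (fun p : I × I => H p.1 p.2)) (hW : ∀ s t, H s t ∈ W)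
    (hl : ∀ s, H s 0 = H s 1) (h : SmallcodimNullIn W (H 1)) : SmallcodimNullIn W (H 0) := by
  obtain ⟨_, _, _, hP⟩ := h
  refine ⟨by fun_prop, hW 0, hl 0, ?_⟩
  have hcont : ∀ s, Continuous (H s) := fun s => hc.comp (Continuous.prodMk_right s)
  let f : I → C(I, W) := fun s => ⟨fun t => ⟨H s t, hW s t⟩, by have := hcont s; fun_prop⟩
  let F : (f 0).Homotopy (f 1) :=
    { toFun := fun p => ⟨H p.1 p.2, hW _ _⟩
      continuous_toFun := by fun_prop
      map_zero_left := fun t => rfl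
      map_one_left := fun t => rfl }
  have key := Path.Homotopic.map_trans_evalAt F unitInterval.path01
  have := smallcodim_conj _ _ _ _ key (Subtype.ext (hl 0)) (Subtype.ext (hl 1))
    (fun t => Subtype.ext (hl t).symm) hP
  exact this

lemma smallcodim_cast_null {Y : Type*} [TopologicalSpace Y] {a b : Y} (γ : Path a a)
    (δ : Path b b) (h : a = b) (hγ : ∀ t, γ t = δ t) (hδ : δ.Homotopic (Path.refl b)) :
    γ.Homotopic (Path.refl a) := by
  subst h
  have : γ = δ := by ext t; exact hγ t
  exact this ▸ hδ

lemma smallcodim_core {m : ℕ} (r : MvPolynomial (Fin m) ℂ) (hr : r ≠ 0)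
    (W : Set ((Fin m → ℂ) × ℂ)) (hWo : IsOpen W)
    (hWr : ∀ x y, MvPolynomial.eval x r ≠ 0 → (x, y) ∈ W)
    (hWR : ∀ ρ : ℝ, ∃ R : ℝ, ∀ (x : Fin m → ℂ) (y : ℂ), ‖x‖ ≤ ρ → R < ‖y‖ → (x, y) ∈ W) :
    SimplyConnectedSpace W := by
  obtain ⟨x₀, hx₀, -⟩ := smallcodim_dense r hr 0 1 one_pos
  have hb : (x₀, (0 : ℂ)) ∈ W := hWr _ _ hx₀
  apply smallcodim_simply_of_base (⟨(x₀, 0), hb⟩ : W)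
  · rintro ⟨⟨x, y⟩, hxy⟩
    rw [← joinedIn_iff_joined]
    obtain ⟨ε, hε, hball⟩ := Metric.isOpen_iff.1 hWo _ hxy
    obtain ⟨x₁, hx₁, hd⟩ := smallcodim_dense r hr x ε hε
    have j1 : JoinedIn W (x₀, 0) (x₀, y) := by
      refine JoinedIn.mono (U := (fun z : ℂ => (x₀, z)) '' Set.univ) ?_ ?_
      · refine IsPathConnected.joinedIn ?_ _ (Set.mem_image_of_mem _ (Set.mem_univ _)) _
          (Set.mem_image_of_mem _ (Set.mem_univ _))
        exact isPathConnected_univ.image (by fun_prop)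
      · rintro _ ⟨z, -, rfl⟩; exact hWr _ _ hx₀
    have j2 : JoinedIn W (x₀, y) (x₁, y) := by
      let γ : C(I, Fin m → ℂ) := (Path.segment x₀ x₁).toContinuousMap
      obtain ⟨γ', a, b, c, -⟩ := smallcodim_approx r γ (by simpa [γ] using hx₀)
        (by simpa [γ] using hx₁) 1 one_pos
      refine ⟨⟨⟨fun t => (γ' t, y), by fun_prop⟩, ?_, ?_⟩, fun t => hWr _ _ (a t)⟩
      · simp [b, γ]
      · simp [c, γ]
    have j3 : JoinedIn W (x₁, y) (x, y) := by
      refine JoinedIn.mono (U := Metric.ball (x, y) ε) ?_ hball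
      refine IsPathConnected.joinedIn ?_ _ ?_ _ (Metric.mem_ball_self hε)
      · exact (convex_ball _ _).isPathConnected ⟨_, Metric.mem_ball_self hε⟩
      · simpa [Prod.dist_eq, hε] using hd
    exact (j1.trans j2).trans j3
  · intro γ
    suffices h : SmallcodimNullIn W (fun t => (γ t : (Fin m → ℂ) × ℂ)) by
      obtain ⟨_, _, _, hP⟩ := h
      refine smallcodim_cast_null γ (Path.mk _ _ _) (Subtype.ext (by simp)) ?_ hP
      exact fun t => rfl
    let x : I → Fin m → ℂ := fun t => (γ t : (Fin m → ℂ) × ℂ).1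
    let y : I → ℂ := fun t => (γ t : (Fin m → ℂ) × ℂ).2
    have hx : Continuous x := by fun_prop
    have hy : Continuous y := by fun_prop
    have hx0 : x 0 = x₀ := by simp [x]
    have hx1 : x 1 = x₀ := by simp [x]
    have hy0 : y 0 = 0 := by simp [y]
    have hy1 : y 1 = 0 := by simp [y]
    have hmem : ∀ t, (x t, y t) ∈ W := fun t => (γ t).2
    change SmallcodimNullIn W (fun t => (x t, y t))
    clear_value x y
    -- step 0
    obtain ⟨ε, hε, hthick⟩ : ∃ ε > 0, ∀ t x', dist x' (x t) < ε → (x', y t) ∈ W := by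
      have hK : IsCompact (Set.range (fun t => (x t, y t))) :=
        isCompact_range (by fun_prop)
      obtain ⟨ε, hε, h⟩ := hK.exists_thickening_subset_open hWo (by
        rintro _ ⟨t, rfl⟩; exact hmem t)
      refine ⟨ε, hε, fun t x' hd => h ?_⟩
      rw [Metric.mem_thickening_iff]
      exact ⟨_, ⟨t, rfl⟩, by simpa [Prod.dist_eq, hε] using hd⟩
    obtain ⟨x', hx'r, hx'0, hx'1, hx'd⟩ := smallcodim_approx r ⟨x, hx⟩ (by simpa [hx0] using hx₀)
        (by simpa [hx1] using hx₀) ε hε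
    simp only [ContinuousMap.coe_mk, hx0, hx1] at hx'0 hx'1 hx'd
    have s0 := smallcodim_null_step W
      (fun s t => ((1 - (s : ℝ)) • x t + (s : ℝ) • x' t, y t)) (by fun_prop)
      (fun s t => by
        apply hthick
        rw [dist_eq_norm]
        have e : (1 - (s : ℝ)) • x t + (s : ℝ) • x' t - x t = (s : ℝ) • (x' t - x t) := by
          module
        rw [e, norm_smul]
        have := hx'd t
        rw [dist_eq_norm] at this
        have h1 : ‖(s : ℝ)‖ ≤ 1 := by
          rw [Real.norm_eq_abs, abs_of_nonneg s.2.1]; exact s.2.2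
        calc _ ≤ 1 * ‖x' t - x t‖ := by gcongr
          _ < ε := by linarith)
      (fun s => by simp [hx0, hx1, hy0, hy1, hx'0, hx'1])
    simp only [Set.Icc.coe_zero, Set.Icc.coe_one, sub_zero, sub_self, zero_smul, one_smul,
      zero_add, add_zero] at s0
    apply s0
    -- bounds
    obtain ⟨ρ, hρ⟩ : ∃ ρ : ℝ, ∀ t, ‖x' t‖ ≤ ρ := by
      obtain ⟨ρ, hρ⟩ := (isCompact_range x'.continuous).isBounded.exists_norm_le
      exact ⟨ρ, fun t => hρ _ ⟨t, rfl⟩⟩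
    obtain ⟨B, hB⟩ : ∃ B : ℝ, ∀ t, ‖y t‖ ≤ B := by
      obtain ⟨ρ, hρ⟩ := (isCompact_range hy).isBounded.exists_norm_le
      exact ⟨ρ, fun t => hρ _ ⟨t, rfl⟩⟩
    obtain ⟨R, hR⟩ := hWR ρ
    let M : ℝ := |R| + B + 1
    have hM : ∀ t, R < ‖y t + (M : ℂ)‖ := by
      intro t
      have h1 : ‖(M : ℂ)‖ ≤ ‖y t + (M : ℂ)‖ + ‖y t‖ := by
        have := norm_sub_le (y t + (M : ℂ)) (y t)
        simpa using this
      have h2 : M ≤ ‖(M : ℂ)‖ := by simpa using le_abs_self M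
      have := hB t
      have := le_abs_self R
      simp only [M] at h1 h2
      simp only [M]
      linarith
    clear_value M
    have s1 := smallcodim_null_step W
      (fun s t => (x' t, y t + (s : ℝ) • (M : ℂ))) (by fun_prop)
      (fun s t => hWr _ _ (hx'r t)) (fun s => by simp [hy0, hy1, hx'0, hx'1])
    simp only [Set.Icc.coe_zero, Set.Icc.coe_one, zero_smul, one_smul, add_zero] at s1
    apply s1
    have s2 := smallcodim_null_step W
      (fun s t => ((1 - (s : ℝ)) • x' t + (s : ℝ) • x₀, y t + (M : ℂ))) (by fun_prop)
      (fun s t => by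
        apply hR _ _ _ (hM t)
        have h0 : ‖x₀‖ ≤ ρ := hx'0 ▸ hρ 0
        have := (convex_closedBall (0 : Fin m → ℂ) ρ) (x := x' t) (y := x₀)
          (by simpa using hρ t) (by simpa using h0) (a := 1 - (s : ℝ)) (b := s)
          (by linarith [s.2.2]) s.2.1 (by ring)
        simpa using this)
      (fun s => by simp [hy0, hy1, hx'0, hx'1])
    simp only [Set.Icc.coe_zero, Set.Icc.coe_one, sub_zero, sub_self, zero_smul, one_smul,
      zero_add, add_zero] at s2
    apply s2
    have s3 := smallcodim_null_step W
      (fun s t => (x₀, (1 - (s : ℝ)) • (y t + (M : ℂ)))) (by fun_prop)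
      (fun s t => hWr _ _ hx₀) (fun s => by simp [hy0, hy1])
    simp only [Set.Icc.coe_zero, Set.Icc.coe_one, sub_zero, sub_self, zero_smul, one_smul] at s3
    exact s3 (smallcodim_null_const W _ hb)

end SmallcodimTop

lemma smallcodim_krull {R S : Type*} [CommRing R] [CommRing S] [Algebra R S]
    [Algebra.IsIntegral R S] (hinj : Function.Injective (algebraMap R S)) :
    ringKrullDim R ≤ ringKrullDim S := by
  have key : ∀ k : ℕ, ∀ l : LTSeries (PrimeSpectrum R), l.length = k →
      ∃ l' : LTSeries (PrimeSpectrum S), l'.length = k ∧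
        PrimeSpectrum.comap (algebraMap R S) l'.last = l.last := by
    intro k
    induction k with
    | zero =>
      intro l hl
      obtain ⟨Q, hQ⟩ := (RingHom.IsIntegral.comap_surjective
        (algebraMap_isIntegral_iff.2 inferInstance) hinj) l.last
      exact ⟨RelSeries.singleton _ Q, rfl, by simpa using hQ⟩
    | succ k ih =>
      intro l hl
      obtain ⟨l', h1, h2⟩ := ih l.eraseLast (by simp [hl])
      have hlt : l.eraseLast.last < l.last := RelSeries.eraseLast_last_rel_last l (by omega)
      obtain ⟨Q, hQ1, hQ2, hQ3⟩ := Ideal.exists_ideal_over_prime_of_isIntegral_of_isPrime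
        l.last.asIdeal l'.last.asIdeal (by
          have := congrArg PrimeSpectrum.asIdeal h2
          simp only [PrimeSpectrum.comap_asIdeal] at this
          rw [this]
          exact hlt.le)
      have hlt' : l'.last < ⟨Q, hQ2⟩ := by
        refine lt_of_le_of_ne hQ1 ?_
        intro h
        rw [h] at h2
        apply hlt.ne
        rw [← h2]
        ext1; exact hQ3
      refine ⟨l'.snoc ⟨Q, hQ2⟩ hlt', congrArg (· + 1) h1, ?_⟩
      · rw [RelSeries.last_snoc]
        ext1; exact hQ3
  apply iSup_le
  intro l
  obtain ⟨l', h1, -⟩ := key _ l rfl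
  rw [← h1]
  exact le_iSup (fun p : LTSeries (PrimeSpectrum S) => (p.length : WithBot ℕ∞)) l'

open Polynomial in
lemma smallcodim_elim_dim {R : Type*} [CommRing R] (J : Ideal R[X]) (F : R[X])
    (hF : F ∈ J) (hu : F.Monic) (hJ : ∀ r : R, C r ∈ J → r = 0) :
    ringKrullDim R ≤ ringKrullDim (R[X] ⧸ J) := by
  have hint : (algebraMap R (R[X] ⧸ J)).IsIntegral := hu.quotient_isIntegral hF
  have : Algebra.IsIntegral R (R[X] ⧸ J) := ⟨hint⟩
  apply smallcodim_krull
  rw [injective_iff_map_eq_zero]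
  intro a ha
  apply hJ
  rw [← Ideal.Quotient.eq_zero_iff_mem]
  exact ha

open Polynomial in
lemma smallcodim_elim {m : ℕ} (J : Ideal (MvPolynomial (Fin m) ℂ)[X])
    (F : (MvPolynomial (Fin m) ℂ)[X]) (hF : F ∈ J) (hu : F.Monic)
    (hdim : ringKrullDim ((MvPolynomial (Fin m) ℂ)[X] ⧸ J) < m) :
    ∃ r : MvPolynomial (Fin m) ℂ, r ≠ 0 ∧ C r ∈ J := by
  by_contra! hcon
  have h1 := smallcodim_elim_dim J F hF hu (fun r hr => by
    by_contra hne; exact hcon r hne hr)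
  rw [MvPolynomial.ringKrullDim_of_isNoetherianRing] at h1
  simp only [ringKrullDim_eq_zero_of_field, Nat.card_eq_fintype_card, Fintype.card_fin,
    zero_add] at h1
  exact absurd hdim (not_lt.2 h1)

/-- Evaluation at a point. -/
noncomputable def smallcodimEv {m : ℕ} (p : (Fin m → ℂ) × ℂ) :
    Polynomial (MvPolynomial (Fin m) ℂ) →ₐ[ℂ] ℂ :=
  { Polynomial.eval₂RingHom (MvPolynomial.eval p.1) p.2 with
    commutes' := fun c => by
      simp [Polynomial.algebraMap_apply] }

lemma smallcodimEv_apply {m : ℕ} (p : (Fin m → ℂ) × ℂ) (q) :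
    smallcodimEv p q = q.eval₂ (MvPolynomial.eval p.1) p.2 := rfl

lemma smallcodimEv_continuous {m : ℕ} (q : Polynomial (MvPolynomial (Fin m) ℂ)) :
    Continuous (fun p => smallcodimEv p q) := by
  simp only [smallcodimEv_apply, Polynomial.eval₂_eq_sum_range]
  refine continuous_finsetSum _ fun i _ => ?_
  refine Continuous.mul ?_ (by fun_prop)
  exact (MvPolynomial.continuous_eval _).comp continuous_fst

lemma smallcodimEv_ext {m : ℕ} {A : Type*} [CommRing A] [Algebra ℂ A]
    (f g : Polynomial (MvPolynomial (Fin m) ℂ) →ₐ[ℂ] A)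
    (h1 : ∀ i, f (Polynomial.C (MvPolynomial.X i)) = g (Polynomial.C (MvPolynomial.X i)))
    (h2 : f Polynomial.X = g Polynomial.X) : f = g := by
  apply AlgHom.coe_ringHom_injective
  apply Polynomial.ringHom_ext'
  · apply MvPolynomial.ringHom_ext
    · intro c
      have e : (Polynomial.C (MvPolynomial.C c) : Polynomial (MvPolynomial (Fin m) ℂ))
        = algebraMap ℂ _ c := by simp [Polynomial.algebraMap_apply, MvPolynomial.algebraMap_eq]
      simp only [RingHom.comp_apply, e]
      exact (f.commutes c).trans (g.commutes c).symm
    · simpa using h1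
  · simpa using h2

/-- The homeomorphism of affine spaces induced by an isomorphism of polynomial rings. -/
noncomputable def smallcodimHomeo {m : ℕ}
    (Φ : MvPolynomial (Fin (m + 1)) ℂ ≃ₐ[ℂ] Polynomial (MvPolynomial (Fin m) ℂ)) :
    ((Fin m → ℂ) × ℂ) ≃ₜ (Fin (m + 1) → ℂ) where
  toFun p := fun i => smallcodimEv p (Φ (MvPolynomial.X i))
  invFun x := (fun j => MvPolynomial.eval x (Φ.symm (Polynomial.C (MvPolynomial.X j))),
    MvPolynomial.eval x (Φ.symm Polynomial.X))
  left_inv p := by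
    have h : (MvPolynomial.aeval (fun i => smallcodimEv p (Φ (MvPolynomial.X i)))) =
        (smallcodimEv p).comp Φ.toAlgHom := by
      ext i; simp
    have h' : ∀ q, MvPolynomial.eval (fun i => smallcodimEv p (Φ (MvPolynomial.X i))) (Φ.symm q) =
        smallcodimEv p q := by
      intro q
      have := DFunLike.congr_fun h (Φ.symm q)
      simpa [MvPolynomial.aeval_eq_eval] using this
    simp only [h']
    simp [smallcodimEv_apply]
  right_inv x := by
    have h : smallcodimEv (fun j => MvPolynomial.eval x (Φ.symm (Polynomial.C (MvPolynomial.X j))),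
        MvPolynomial.eval x (Φ.symm Polynomial.X)) =
        (MvPolynomial.aeval x).comp Φ.symm.toAlgHom := by
      apply smallcodimEv_ext
      · intro i; simp [smallcodimEv_apply, MvPolynomial.aeval_eq_eval]
      · simp [smallcodimEv_apply, MvPolynomial.aeval_eq_eval]
    ext i
    simp [h]
  continuous_toFun := continuous_pi fun i => smallcodimEv_continuous _
  continuous_invFun := by
    refine Continuous.prodMk (continuous_pi fun i => ?_) ?_ <;>
    exact MvPolynomial.continuous_eval _

lemma smallcodimHomeo_eval {m : ℕ}
    (Φ : MvPolynomial (Fin (m + 1)) ℂ ≃ₐ[ℂ] Polynomial (MvPolynomial (Fin m) ℂ)) (p) (q) :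
    MvPolynomial.eval (smallcodimHomeo Φ p) q = smallcodimEv p (Φ q) := by
  have h : (MvPolynomial.aeval (smallcodimHomeo Φ p)) =
        (smallcodimEv p).comp Φ.toAlgHom := by
      ext i; simp [smallcodimHomeo]
  have := DFunLike.congr_fun h q
  simpa [MvPolynomial.aeval_eq_eval] using this

lemma smallcodim_bound {m : ℕ} (F : Polynomial (MvPolynomial (Fin m) ℂ)) (hF : F.Monic) (ρ : ℝ) :
    ∃ R : ℝ, ∀ (x : Fin m → ℂ) (y : ℂ), ‖x‖ ≤ ρ → R < ‖y‖ → smallcodimEv (x, y) F ≠ 0 := by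
  have hK : IsCompact (Metric.closedBall (0 : Fin m → ℂ) ρ) := isCompact_closedBall _ _
  have hb : ∀ i : ℕ, ∃ B : NNReal, ∀ x : Fin m → ℂ, ‖x‖ ≤ ρ →
      ‖MvPolynomial.eval x (F.coeff i)‖₊ ≤ B := by
    intro i
    obtain ⟨B, hB⟩ := (hK.image (MvPolynomial.continuous_eval (F.coeff i))).isBounded.exists_norm_le
    refine ⟨B.toNNReal, fun x hx => ?_⟩
    have := hB _ ⟨x, by simpa using hx, rfl⟩
    exact NNReal.coe_le_coe.1 (by simpa using Or.inl this)
  choose B hB using hb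
  refine ⟨((Finset.range F.natDegree).sup B + 1 : NNReal), fun x y hx hy h0 => ?_⟩
  have hm := hF.map (MvPolynomial.eval x)
  have hroot : (F.map (MvPolynomial.eval x)).IsRoot y := by
    rw [Polynomial.IsRoot, Polynomial.eval_map]; exact h0
  have h1 := hroot.norm_lt_cauchyBound hm.ne_zero
  have h2 : (F.map (MvPolynomial.eval x)).cauchyBound ≤ (Finset.range F.natDegree).sup B + 1 := by
    rw [Polynomial.cauchyBound, hm.leadingCoeff, hF.natDegree_map]
    simp only [nnnorm_one, div_one]
    gcongr
    rename_i i _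
    rw [Polynomial.coeff_map]
    exact hB i x hx
  have h3 : (‖y‖₊ : ℝ) < ((Finset.range F.natDegree).sup B + 1 : NNReal) :=
    NNReal.coe_lt_coe.2 (h1.trans_le h2)
  simp only [coe_nnnorm] at h3
  linarith

/-- If `I` is an ideal of `ℂ[x₁,…,xₙ]` (`n ≥ 2`) such that the Krull
dimension of `ℂ[x₁,…,xₙ]/I` is at most `n - 2`, then the complement in `ℂⁿ` of the zero
locus `V` of `I` is simply connected. -/
theorem complement_of_small_zero_locus_simplyConnected
    (n : ℕ) (hn : 2 ≤ n) (I : Ideal (MvPolynomial (Fin n) ℂ))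
    (hdim : ringKrullDim (MvPolynomial (Fin n) ℂ ⧸ I) ≤ ((n - 2 : ℕ) : WithBot (WithTop ℕ)))
    (V : Set (Fin n → ℂ))
    (hV : V = {x : Fin n → ℂ | ∀ p ∈ I, MvPolynomial.eval x p = 0}) :
    SimplyConnectedSpace ↥Vᶜ := by
  obtain ⟨m, rfl⟩ : ∃ m, n = m + 1 := ⟨n - 1, by omega⟩
  have hdim' : ringKrullDim (MvPolynomial (Fin (m + 1)) ℂ ⧸ I) < m := by
    refine lt_of_le_of_lt hdim ?_
    have : m + 1 - 2 < m := by omega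
    change ((m + 1 - 2 : ℕ) : WithBot ℕ∞) < ((m : ℕ) : WithBot ℕ∞)
    exact_mod_cast this
  have hI : I ≠ ⊥ := by
    rintro rfl
    rw [ringKrullDim_eq_of_ringEquiv (RingEquiv.quotientBot _),
      MvPolynomial.ringKrullDim_of_isNoetherianRing] at hdim'
    simp only [ringKrullDim_eq_zero_of_field, Nat.card_eq_fintype_card, Fintype.card_fin,
      zero_add] at hdim'
    have : m + 1 < m := by exact_mod_cast hdim'
    omega
  obtain ⟨f, hfI, hf0⟩ := Submodule.exists_mem_ne_zero_of_ne_bot hI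
  let Φ : MvPolynomial (Fin (m + 1)) ℂ ≃ₐ[ℂ] Polynomial (MvPolynomial (Fin m) ℂ) :=
    (SmallcodimNN.T f).trans (MvPolynomial.finSuccEquiv ℂ m)
  have hu : IsUnit (Φ f).leadingCoeff := SmallcodimNN.T_leadingcoeff_isUnit f hf0
  let J : Ideal (Polynomial (MvPolynomial (Fin m) ℂ)) := I.map (Φ : _ →+* _)
  have hmemJ : ∀ q ∈ I, Φ q ∈ J := fun q hq => Ideal.mem_map_of_mem _ hq
  have hJmem : ∀ q ∈ J, ∃ p ∈ I, Φ p = q := fun q hq =>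
    (Ideal.mem_map_iff_of_surjective _ Φ.surjective).1 hq
  have hJdim : ringKrullDim (Polynomial (MvPolynomial (Fin m) ℂ) ⧸ J) < m := by
    rwa [← ringKrullDim_eq_of_ringEquiv (Ideal.quotientEquiv I J Φ.toRingEquiv rfl)]
  have hFm := Polynomial.monic_of_isUnit_leadingCoeff_inv_smul hu
  set F := hu.unit⁻¹ • Φ f with hFdef
  have hFJ : F ∈ J := Submodule.smul_of_tower_mem _ hu.unit⁻¹.val (hmemJ f hfI)
  obtain ⟨r, hr0, hrJ⟩ := smallcodim_elim J F hFJ hFm hJdim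
  have hVclosed : IsClosed V := by
    have : V = ⋂ p ∈ I, {x | MvPolynomial.eval x p = 0} := by ext x; simp [hV]
    rw [this]
    exact isClosed_biInter fun p _ =>
      isClosed_eq (MvPolynomial.continuous_eval p) continuous_const
  have hW : ∀ p, ∀ q ∈ J, smallcodimEv p q ≠ 0 → p ∈ smallcodimHomeo Φ ⁻¹' Vᶜ := by
    intro p q hq hne hp
    obtain ⟨q', hq', rfl⟩ := hJmem q hq
    rw [hV] at hp
    apply hne
    rw [← smallcodimHomeo_eval]
    exact hp q' hq'
  have key : SimplyConnectedSpace (smallcodimHomeo Φ ⁻¹' Vᶜ) := by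
    apply smallcodim_core r hr0
    · exact hVclosed.isOpen_compl.preimage (smallcodimHomeo Φ).continuous
    · intro x y hx
      exact hW _ _ hrJ (by simpa [smallcodimEv_apply] using hx)
    · intro ρ
      obtain ⟨R, hR⟩ := smallcodim_bound F hFm ρ
      exact ⟨R, fun x y hx hy => hW _ _ hFJ (hR x y hx hy)⟩
  exact (smallcodimHomeo Φ).isSimplyConnected_preimage.1 key
end

section
/- Let n ≥ 1 and let S be a set of homogeneous polynomials in ℂ[x₀,…,xₙ], generating an ideal I such that the Krull dimension of ℂ[x₀,…,xₙ]/I is at most n − 1. Let V ⊆ ℙⁿ(ℂ) be the set of points [x₀ : ⋯ : xₙ] all of whose homogeneous representatives satisfy p(x) = 0 for every p ∈ S (this is well defined by homogeneity). Then ℙⁿ(ℂ) \ V, with the subspace topology, is simply connected. -/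
/-- The scalar equivalence on `ℂ^{n+1} \ {0}`: `x ~ y` iff `y = t • x` for some `t ∈ ℂ*`. -/
def projRel (n : ℕ) (x y : {v : Fin (n + 1) → ℂ // v ≠ 0}) : Prop :=
  ∃ t : ℂ, t ≠ 0 ∧ ∀ i, (y : Fin (n + 1) → ℂ) i = t * (x : Fin (n + 1) → ℂ) i

/-- Complex projective `n`-space `ℙⁿ(ℂ)`, as the quotient topological space of
`ℂ^{n+1} \ {0}` (Euclidean topology) by the scalar action of `ℂ*`. -/
def ProjSpace (n : ℕ) : Type :=
  Quot (projRel n)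

instance (n : ℕ) : TopologicalSpace (ProjSpace n) :=
  inferInstanceAs (TopologicalSpace (Quot (projRel n)))


open Topology
open scoped unitInterval

/-- `x` is a homogeneous representative of `z`. -/
def IsRep {n : ℕ} (x : Fin (n + 1) → ℂ) (z : ProjSpace n) : Prop :=
  ∃ h : x ≠ 0, (Quot.mk (projRel n) ⟨x, h⟩ : ProjSpace n) = z

lemma projRel_equivalence (n : ℕ) : Equivalence (projRel n) where
  refl x := ⟨1, one_ne_zero, fun i => by simp⟩
  symm := by
    rintro x y ⟨t, ht, h⟩
    exact ⟨t⁻¹, inv_ne_zero ht, fun i => by rw [h]; field_simp⟩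
  trans := by
    rintro x y z ⟨t, ht, h⟩ ⟨u, hu, h'⟩
    exact ⟨u * t, mul_ne_zero hu ht, fun i => by rw [h', h]; ring⟩

lemma mk_eq_mk_iff {n : ℕ} (x y : {v : Fin (n + 1) → ℂ // v ≠ 0}) :
    Quot.mk (projRel n) x = Quot.mk (projRel n) y ↔ projRel n x y :=
  ⟨fun h => (projRel_equivalence n).eqvGen_iff.1 (Quot.eqvGen_exact h), fun h => Quot.sound h⟩

lemma IsRep.smul {n : ℕ} {x : Fin (n + 1) → ℂ} {z : ProjSpace n} (h : IsRep x z) {c : ℂ}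
    (hc : c ≠ 0) : IsRep (c • x) z := by
  obtain ⟨h0, rfl⟩ := h
  refine ⟨smul_ne_zero hc h0, ?_⟩
  exact ((mk_eq_mk_iff _ _).2 ⟨c, hc, fun i => by simp⟩).symm

lemma IsRep.exists_smul {n : ℕ} {x y : Fin (n + 1) → ℂ} {z : ProjSpace n} (h : IsRep x z)
    (h' : IsRep y z) : ∃ c : ℂ, c ≠ 0 ∧ y = c • x := by
  obtain ⟨h0, rfl⟩ := h
  obtain ⟨h1, h2⟩ := h'
  obtain ⟨c, hc, h3⟩ := (mk_eq_mk_iff _ _).1 h2.symm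
  exact ⟨c, hc, funext fun i => by simpa using h3 i⟩

/-- The affine chart where the `i`-th coordinate does not vanish. -/
def chartSet (n : ℕ) (i : Fin (n + 1)) : Set (ProjSpace n) :=
  {z | ∃ x, IsRep x z ∧ x i ≠ 0}

/-- The normalised representative in the chart. -/
noncomputable def chartSection (n : ℕ) (i : Fin (n + 1)) (z : ProjSpace n) : Fin (n + 1) → ℂ :=
  Quot.lift (fun x : {v : Fin (n + 1) → ℂ // v ≠ 0} => ((x.1 i)⁻¹ • x.1 : Fin (n + 1) → ℂ)) (by
    rintro x y ⟨t, ht, h⟩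
    funext j
    simp only [Pi.smul_apply, smul_eq_mul, h]
    by_cases hx : x.1 i = 0
    · simp [hx]
    · field_simp) z

lemma mk_mem_chartSet {n : ℕ} (i : Fin (n + 1)) (x : {v : Fin (n + 1) → ℂ // v ≠ 0}) :
    (Quot.mk (projRel n) x : ProjSpace n) ∈ chartSet n i ↔ x.1 i ≠ 0 := by
  constructor
  · rintro ⟨y, hy, hi⟩
    obtain ⟨c, hc, h⟩ := hy.exists_smul (y := x.1) ⟨x.2, rfl⟩
    rw [h]; simp [hc, hi]
  · intro h
    exact ⟨x.1, ⟨x.2, rfl⟩, h⟩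

/-- The quotient map onto projective space. -/
def projMk (n : ℕ) (x : {v : Fin (n + 1) → ℂ // v ≠ 0}) : ProjSpace n := Quot.mk (projRel n) x

lemma isQuotientMap_mk (n : ℕ) : IsQuotientMap (projMk n) :=
  isQuotientMap_quot_mk

lemma isOpen_chartSet (n : ℕ) (i : Fin (n + 1)) : IsOpen (chartSet n i) := by
  rw [← (isQuotientMap_mk n).isOpen_preimage]
  have : projMk n ⁻¹' (chartSet n i) =
      {x | x.1 i ≠ 0} := by
    ext x; exact mk_mem_chartSet i x
  rw [this]
  exact isOpen_ne_fun ((continuous_apply i).comp continuous_subtype_val) continuous_const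

lemma continuousOn_chartSection (n : ℕ) (i : Fin (n + 1)) :
    ContinuousOn (chartSection n i) (chartSet n i) := by
  rw [(isQuotientMap_mk n).continuousOn_isOpen_iff (isOpen_chartSet n i)]
  have : ContinuousOn (fun x : {v : Fin (n + 1) → ℂ // v ≠ 0} =>
      ((x.1 i)⁻¹ • x.1 : Fin (n + 1) → ℂ))
      (projMk n ⁻¹' (chartSet n i)) := by
    have h1 : Continuous fun x : {v : Fin (n + 1) → ℂ // v ≠ 0} => x.1 i :=
      (continuous_apply i).comp continuous_subtype_val
    have h2 := h1.continuousOn.inv₀ fun x (hx : x ∈ projMk n ⁻¹' chartSet n i) =>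
      (mk_mem_chartSet i x).1 hx
    exact h2.smul continuous_subtype_val.continuousOn
  exact this

lemma isRep_chartSection {n : ℕ} {i : Fin (n + 1)} {z : ProjSpace n} (hz : z ∈ chartSet n i) :
    IsRep (chartSection n i z) z := by
  obtain ⟨x, hx, hi⟩ := hz
  have h2 := hx.smul (inv_ne_zero hi)
  obtain ⟨h, rfl⟩ := hx
  exact h2

lemma exists_lift {n : ℕ} (γ : C(I, ProjSpace n)) :
    ∃ f : C(I, Fin (n + 1) → ℂ), ∀ t, IsRep (f t) (γ t) := by
  obtain ⟨t, ht0, htm, ⟨m, hm⟩, hc⟩ := exists_monotone_Icc_subset_open_cover_unitInterval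
    (c := fun i => γ ⁻¹' (chartSet n i)) (fun i => (isOpen_chartSet n i).preimage γ.continuous)
    (by
      intro s _
      obtain ⟨x, hx⟩ : ∃ x, Quot.mk (projRel n) x = γ s := Quot.exists_rep (γ s)
      obtain ⟨i, hi⟩ := Function.ne_iff.1 x.2
      exact Set.mem_iUnion.2 ⟨i, ⟨x.1, ⟨x.2, hx⟩, hi⟩⟩)
  have key : ∀ k, ∃ f : I → Fin (n + 1) → ℂ, ContinuousOn f (Set.Icc 0 (t k)) ∧
      ∀ s ∈ Set.Icc 0 (t k), IsRep (f s) (γ s) := by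
    intro k
    induction k with
    | zero =>
      rw [ht0]
      obtain ⟨x, hx⟩ : ∃ x, Quot.mk (projRel n) x = γ 0 := Quot.exists_rep (γ 0)
      refine ⟨fun _ => x.1, continuousOn_const, fun s hs => ?_⟩
      have : s = 0 := le_antisymm hs.2 hs.1
      subst this
      exact ⟨x.2, hx⟩
    | succ k ih =>
      obtain ⟨f, hf, hr⟩ := ih
      obtain ⟨i, hi⟩ := hc k
      have hle : t k ≤ t (k + 1) := htm (Nat.le_succ k)
      obtain ⟨c, hc0, hcs⟩ := (isRep_chartSection (hi ⟨le_rfl, hle⟩)).exists_smul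
        (hr (t k) ⟨unitInterval.nonneg', le_rfl⟩)
      let g : I → Fin (n + 1) → ℂ := fun s =>
        if s ≤ t k then f s else c • chartSection n i (γ s)
      have hg1 : Set.EqOn g f (Set.Icc 0 (t k)) := fun s hs => if_pos hs.2
      have hg2 : Set.EqOn g (fun s => c • chartSection n i (γ s)) (Set.Icc (t k) (t (k + 1))) := by
        intro s hs
        by_cases h : s ≤ t k
        · have : s = t k := le_antisymm h hs.1
          subst this
          simp [g, hcs]
        · simp [g, h]
      have hun : Set.Icc 0 (t (k + 1)) = Set.Icc 0 (t k) ∪ Set.Icc (t k) (t (k + 1)) :=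
        (Set.Icc_union_Icc_eq_Icc unitInterval.nonneg' hle).symm
      refine ⟨g, ?_, ?_⟩
      · rw [hun]
        refine ContinuousOn.union_of_isClosed (hf.congr hg1) (ContinuousOn.congr ?_ hg2)
          isClosed_Icc isClosed_Icc
        refine ContinuousOn.const_smul ?_ c
        exact (continuousOn_chartSection n i).comp γ.continuous.continuousOn hi
      · rw [hun]
        rintro s (hs | hs)
        · rw [hg1 hs]; exact hr s hs
        · rw [hg2 hs]; exact (isRep_chartSection (hi hs)).smul hc0
  obtain ⟨f, hf, hr⟩ := key m
  rw [hm m le_rfl] at hf hr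
  have hI : Set.Icc (0 : I) 1 = Set.univ := by
    ext s; simp [unitInterval.le_one']
  rw [hI] at hf hr
  exact ⟨⟨f, continuousOn_univ.1 hf⟩, fun s => hr s trivial⟩

lemma exists_loop_lift {n : ℕ} (γ : C(I, ProjSpace n)) (hγ : γ 0 = γ 1) :
    ∃ φ : C(AddCircle (1 : ℝ), Fin (n + 1) → ℂ), ∀ t : I, IsRep (φ ((t : ℝ) : AddCircle (1 : ℝ))) (γ t) := by
  obtain ⟨f, hf⟩ := exists_lift γ
  obtain ⟨c, hc, hcf⟩ := (hf 0).exists_smul (hγ ▸ hf 1)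
  let g : ℝ → Fin (n + 1) → ℂ := fun s =>
    Complex.exp (-(s * Complex.log c)) • f (Set.projIcc 0 1 zero_le_one s)
  have hg : Continuous g := by
    have : Continuous (Set.projIcc (0 : ℝ) 1 zero_le_one) := continuous_projIcc
    fun_prop
  have h01 : g 0 = g (0 + 1) := by
    simp only [g, zero_add, Set.projIcc_left, Set.projIcc_right]
    change _ • f 0 = _ • f 1
    rw [hcf, smul_smul]
    simp [Complex.exp_neg, Complex.exp_log hc, hc]
  have hfact : Fact (0 < (1 : ℝ)) := ⟨one_pos⟩
  have hgt : ∀ t : I, IsRep (g t) (γ t) := by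
    intro t
    simp only [g, Set.projIcc_val]
    exact (hf t).smul (Complex.exp_ne_zero _)
  refine ⟨⟨AddCircle.liftIco 1 0 g, AddCircle.liftIco_continuous h01 hg.continuousOn⟩, fun t => ?_⟩
  rcases eq_or_lt_of_le t.2.2 with h | h
  · have h1 : t = 1 := Subtype.ext h
    subst h1
    have h2 : (((1 : I) : ℝ) : AddCircle (1 : ℝ)) = ((0 : ℝ) : AddCircle (1 : ℝ)) := by
      simp
    rw [h2]
    have h3 : AddCircle.liftIco 1 0 g ((0 : ℝ) : AddCircle (1 : ℝ)) = g 0 :=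
      AddCircle.liftIco_coe_apply (by simp)
    have h4 := hgt 1
    change IsRep (AddCircle.liftIco 1 0 g ((0 : ℝ) : AddCircle (1 : ℝ))) _
    rw [h3, h01]
    simpa using h4
  · have h3 : AddCircle.liftIco 1 0 g ((t : ℝ) : AddCircle (1 : ℝ)) = g t :=
      AddCircle.liftIco_coe_apply ⟨t.2.1, by simpa using h⟩
    change IsRep (AddCircle.liftIco 1 0 g ((t : ℝ) : AddCircle (1 : ℝ))) _
    rw [h3]
    exact hgt t

lemma natCast_le_ringKrullDim_of_integral {s : ℕ} {A : Type} [CommRing A] [Algebra ℂ A]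
    (g : MvPolynomial (Fin s) ℂ →ₐ[ℂ] A) (hg : Function.Injective g)
    (hgInt : g.IsIntegral) : (s : WithBot ℕ∞) ≤ ringKrullDim A := by
  have h1 : ringKrullDim (MvPolynomial (Fin s) ℂ) = s := by
    simp [MvPolynomial.ringKrullDim_of_isNoetherianRing]
  rw [← h1]
  let : Algebra (MvPolynomial (Fin s) ℂ) A := g.toRingHom.toAlgebra
  have : Algebra.IsIntegral (MvPolynomial (Fin s) ℂ) A := ⟨hgInt⟩
  have : Algebra.HasGoingUp (MvPolynomial (Fin s) ℂ) A := inferInstance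
  unfold ringKrullDim Order.krullDim
  refine iSup_le fun l => ?_
  have hker : RingHom.ker (algebraMap (MvPolynomial (Fin s) ℂ) A) = ⊥ :=
    (RingHom.injective_iff_ker_eq_bot _).1 hg
  obtain ⟨P, -, hP, hP'⟩ := Ideal.exists_ideal_over_prime_of_isIntegral
    (RelSeries.head l).asIdeal (⊥ : Ideal A) (by
      rw [← RingHom.ker_eq_comap_bot, hker]; exact bot_le)
  have : P.LiesOver (RelSeries.head l).asIdeal := ⟨hP'.symm⟩
  obtain ⟨L, hL, -⟩ := Ideal.exists_ltSeries_of_hasGoingUp l P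
  rw [← hL]
  exact le_iSup (fun p : LTSeries (PrimeSpectrum A) => (p.length : WithBot ℕ∞)) L

lemma natCast_le_ringKrullDim_of_injective_of_isDomain {N : ℕ} {A : Type} [CommRing A] [IsDomain A]
    [Algebra ℂ A] [Algebra.FiniteType ℂ A]
    (f : MvPolynomial (Fin N) ℂ →ₐ[ℂ] A) (hf : Function.Injective f) :
    (N : WithBot ℕ∞) ≤ ringKrullDim A := by
  obtain ⟨s, g, hg, hgInt⟩ := exists_integral_inj_algHom_of_fg ℂ A
  refine le_trans ?_ (natCast_le_ringKrullDim_of_integral g hg hgInt)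
  have h1 : Algebra.trdeg ℂ (MvPolynomial (Fin N) ℂ) ≤ Algebra.trdeg ℂ A :=
    trdeg_le_of_injective f hf
  have h2 : Algebra.trdeg ℂ A ≤ s := by
    let : Algebra (MvPolynomial (Fin s) ℂ) A := g.toRingHom.toAlgebra
    have : Algebra.IsIntegral (MvPolynomial (Fin s) ℂ) A := ⟨hgInt⟩
    have hr : Algebra.adjoin ℂ (Set.range fun i => g (MvPolynomial.X i)) = g.range := by
      rw [← MvPolynomial.aeval_range]
      congr 1
      ext; simp
    have : Algebra.IsAlgebraic (Algebra.adjoin ℂ (Set.range fun i => g (MvPolynomial.X i))) A := by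
      rw [hr]
      constructor
      intro a
      obtain ⟨p, hp, hp0⟩ := hgInt a
      refine IsIntegral.isAlgebraic ⟨p.map g.rangeRestrict.toRingHom, hp.map _, ?_⟩
      rw [Polynomial.eval₂_map]
      exact hp0
    have := Algebra.IsAlgebraic.trdeg_le_cardinalMk ℂ (Set.range fun i => g (MvPolynomial.X i))
    refine this.trans ((Cardinal.mk_range_le).trans (by simp))
  rw [MvPolynomial.trdeg_of_isDomain] at h1
  have h3 := h1.trans h2
  simp at h3
  exact_mod_cast h3

lemma natCast_le_ringKrullDim_of_injective {N : ℕ} {A : Type} [CommRing A]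
    [Algebra ℂ A] [Algebra.FiniteType ℂ A]
    (f : MvPolynomial (Fin N) ℂ →ₐ[ℂ] A) (hf : Function.Injective f) :
    (N : WithBot ℕ∞) ≤ ringKrullDim A := by
  obtain ⟨p, hp, hpf⟩ := Ideal.exists_comap_eq_of_mem_minimalPrimes_of_injective
    (f := f.toRingHom) hf ⊥ (by
      rw [IsDomain.minimalPrimes_eq_singleton_bot]; rfl)
  refine le_trans (natCast_le_ringKrullDim_of_injective_of_isDomain
    ((Ideal.Quotient.mkₐ ℂ p).comp f) ?_) (ringKrullDim_quotient_le p)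
  rw [← AlgHom.coe_toRingHom, RingHom.injective_iff_ker_eq_bot, ← hpf]
  ext x
  simp [RingHom.mem_ker, Ideal.Quotient.eq_zero_iff_mem]

lemma exists_avoiding_polynomial (n : ℕ) (hn : 1 ≤ n)
    (J : Ideal (MvPolynomial (Fin (n + 1)) ℂ))
    (hdim : ringKrullDim (MvPolynomial (Fin (n + 1)) ℂ ⧸ J) ≤
      ((n - 1 : ℕ) : WithBot ℕ∞))
    (Q : Fin (n + 1) → Polynomial ℂ) :
    ∃ g : MvPolynomial (Fin (n + 1)) ℂ, g ≠ 0 ∧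
      ∀ x : Fin (n + 1) → ℂ, (∀ p ∈ J, MvPolynomial.eval x p = 0) → ∀ w : ℂ,
        MvPolynomial.eval (fun i => x i - (Q i).eval w) g = 0 := by
  let f : MvPolynomial (Fin (n + 1)) ℂ →ₐ[ℂ] Polynomial (MvPolynomial (Fin (n + 1)) ℂ ⧸ J) :=
    MvPolynomial.aeval fun i => Polynomial.C (Ideal.Quotient.mk J (MvPolynomial.X i)) -
      (Q i).map (algebraMap ℂ (MvPolynomial (Fin (n + 1)) ℂ ⧸ J))
  have hni : ¬ Function.Injective f := by
    intro hf
    have h1 := natCast_le_ringKrullDim_of_injective (N := n + 1)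
      (A := Polynomial (MvPolynomial (Fin (n + 1)) ℂ ⧸ J)) f hf
    rw [Polynomial.ringKrullDim_of_isNoetherianRing] at h1
    have h2 := h1.trans (add_le_add_left hdim 1)
    have h3 : ((n - 1 : ℕ) : WithBot ℕ∞) + 1 = ((n : ℕ) : WithBot ℕ∞) := by
      have : n = (n - 1) + 1 := by omega
      conv_rhs => rw [this]
      push_cast; rfl
    rw [h3] at h2
    have : n + 1 ≤ n := by exact_mod_cast h2
    omega
  rw [injective_iff_map_eq_zero] at hni
  push Not at hni
  obtain ⟨g, hg0, hg⟩ := hni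
  refine ⟨g, hg, fun x hx w => ?_⟩
  let ev : (MvPolynomial (Fin (n + 1)) ℂ ⧸ J) →+* ℂ :=
    Ideal.Quotient.lift J (MvPolynomial.eval x) hx
  let ew : Polynomial (MvPolynomial (Fin (n + 1)) ℂ ⧸ J) →+* ℂ := Polynomial.eval₂RingHom ev w
  have hev : ev.comp (algebraMap ℂ (MvPolynomial (Fin (n + 1)) ℂ ⧸ J)) = RingHom.id ℂ := by
    ext c
    change MvPolynomial.eval x (MvPolynomial.C c) = c
    simp
  have key : ew.comp f.toRingHom = MvPolynomial.eval (fun i => x i - (Q i).eval w) := by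
    apply MvPolynomial.ringHom_ext
    · intro c
      have h1 : f (MvPolynomial.C c) = Polynomial.C (algebraMap ℂ _ c) := f.commutes c
      have h2 := congrArg (fun φ => φ c) hev
      simp only [RingHom.comp_apply, RingHom.id_apply] at h2
      simp [ew, h1, h2]
    · intro i
      have h3 : ev (Ideal.Quotient.mk J (MvPolynomial.X i)) = x i := by simp [ev]
      simp [f, ew, Polynomial.eval₂_map, hev, h3]
  have := congrArg (fun φ => φ g) key
  simp only [RingHom.comp_apply] at this
  rw [← this]
  change ew (f g) = 0
  rw [hg0, map_zero]

lemma small_nonvanishing {N : ℕ} (g : MvPolynomial (Fin N) ℂ) (hg : g ≠ 0) (ε : ℝ) (hε : 0 < ε) :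
    ∃ v : Fin N → ℂ, ‖v‖ < ε ∧ MvPolynomial.eval v g ≠ 0 := by
  by_contra hcon
  push Not at hcon
  apply hg
  refine MvPolynomial.funext_set (s := fun _ => Metric.ball (0 : ℂ) ε) (fun _ => ?_) ?_
  · exact infinite_of_mem_nhds 0 (Metric.ball_mem_nhds 0 hε)
  · intro x hx
    rw [map_zero]
    refine hcon x ?_
    rw [pi_norm_lt_iff hε]
    intro i
    simpa using hx i (Set.mem_univ i)

lemma dim_origin (N : ℕ) :
    ringKrullDim (MvPolynomial (Fin N) ℂ ⧸
      RingHom.ker (MvPolynomial.eval (0 : Fin N → ℂ))) = 0 := by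
  have hs : Function.Surjective (MvPolynomial.eval (0 : Fin N → ℂ)) := fun c =>
    ⟨MvPolynomial.C c, by simp⟩
  rw [ringKrullDim_eq_of_ringEquiv (RingHom.quotientKerEquivOfSurjective hs)]
  exact ringKrullDim_eq_zero_of_field ℂ

lemma contractible_square : ContractibleSpace (I × I) := by
  rw [contractible_iff_id_nullhomotopic]
  refine ⟨(0, 0), ⟨⟨⟨fun q => (unitInterval.symm q.1 * q.2.1, unitInterval.symm q.1 * q.2.2), by fun_prop⟩, ?_, ?_⟩⟩⟩
  · intro x; simp
  · intro x; simp

/-- free null-homotopy to based null-homotopy -/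
lemma path_homotopic_refl_of_free {X : Type*} [TopologicalSpace X] {x c : X} (γ : Path x x)
    (F : C(I × I, X)) (h0 : ∀ t, F (0, t) = γ t) (h1 : ∀ t, F (1, t) = c)
    (hF : ∀ s, F (s, 0) = F (s, 1)) : γ.Homotopic (Path.refl x) := by
  let b : Path ((0, 0) : I × I) (0, 1) :=
    { toFun := fun t => (0, t), source' := rfl, target' := rfl }
  let l : Path ((0, 0) : I × I) (1, 0) :=
    { toFun := fun t => (t, 0), source' := rfl, target' := rfl }
  let tp : Path ((1, 0) : I × I) (1, 1) :=
    { toFun := fun t => (1, t), source' := rfl, target' := rfl }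
  let r : Path ((0, 1) : I × I) (1, 1) :=
    { toFun := fun t => (t, 1), source' := rfl, target' := rfl }
  have := contractible_square
  have hb : b.Homotopic (l.trans (tp.trans r.symm)) := SimplyConnectedSpace.paths_homotopic _ _
  have hb' := hb.map F
  let τ : Path x c :=
    { toFun := fun s => F (s, 0), source' := by simp [h0], target' := by simp [h1] }
  have e0 : x = F (0, 0) := by simp [h0]
  have e1 : x = F (0, 1) := by simp [h0]
  have k1 : (b.map F.continuous).cast e0 e1 = γ := by
    ext t; simp [b, h0]
  have k2 : ((l.trans (tp.trans r.symm)).map F.continuous).cast e0 e1 =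
      τ.trans ((Path.refl c).trans τ.symm) := by
    ext t
    simp only [Path.cast_coe, Path.map_coe, Function.comp_apply, Path.trans_apply, Path.symm_apply]
    split_ifs <;> simp [l, tp, r, τ, h1, hF]
  have hb2 : ((b.map F.continuous).cast e0 e1).Homotopic
      (((l.trans (tp.trans r.symm)).map F.continuous).cast e0 e1) := by
    obtain ⟨H⟩ := hb'
    exact ⟨H.cast rfl rfl⟩
  rw [k1, k2] at hb2
  refine hb2.trans ?_
  have m1 : (τ.trans ((Path.refl c).trans τ.symm)).Homotopic (τ.trans τ.symm) :=
    Path.Homotopic.hcomp (Path.Homotopic.refl _) ⟨Path.Homotopy.reflTrans _⟩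
  exact m1.trans ⟨(Path.Homotopy.reflTransSymm τ).symm⟩

/-- trigonometric approximation, one coordinate -/
lemma trig_span (p : C(AddCircle (1 : ℝ), ℂ)) (hp : p ∈ Submodule.span ℂ (Set.range (@fourier 1))) :
    ∃ M₀ : ℕ, ∀ M ≥ M₀, ∃ Q : Polynomial ℂ, ∀ t : AddCircle (1 : ℝ),
      p t = ((AddCircle.toCircle t : ℂ) ^ M)⁻¹ * Q.eval (AddCircle.toCircle t : ℂ) := by
  induction hp using Submodule.span_induction with
  | mem p h =>
    obtain ⟨k, rfl⟩ := h
    refine ⟨k.natAbs, fun M hM => ⟨Polynomial.X ^ (k + M).toNat, fun t => ?_⟩⟩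
    have hne : (AddCircle.toCircle t : ℂ) ≠ 0 := Circle.coe_ne_zero _
    have h1 : ((k + M).toNat : ℤ) = k + M := Int.toNat_of_nonneg (by omega)
    rw [fourier_apply, AddCircle.toCircle_zsmul, Polynomial.eval_pow, Polynomial.eval_X,
      ← zpow_natCast (AddCircle.toCircle t : ℂ) (k + M).toNat, h1, zpow_add₀ hne, zpow_natCast]
    have : (AddCircle.toCircle t : ℂ) ^ M ≠ 0 := pow_ne_zero _ hne
    push_cast
    field_simp
  | zero => exact ⟨0, fun M _ => ⟨0, fun t => by simp⟩⟩
  | add p q _ _ h1 h2 =>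
    obtain ⟨M1, h1⟩ := h1
    obtain ⟨M2, h2⟩ := h2
    refine ⟨max M1 M2, fun M hM => ?_⟩
    obtain ⟨Q1, h1⟩ := h1 M (le_of_max_le_left hM)
    obtain ⟨Q2, h2⟩ := h2 M (le_of_max_le_right hM)
    exact ⟨Q1 + Q2, fun t => by simp [h1, h2, mul_add]⟩
  | smul a p _ h1 =>
    obtain ⟨M1, h1⟩ := h1
    refine ⟨M1, fun M hM => ?_⟩
    obtain ⟨Q1, h1⟩ := h1 M hM
    exact ⟨Polynomial.C a * Q1, fun t => by simp [h1]; ring⟩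

lemma trig_approx {N : ℕ} (φ : C(AddCircle (1 : ℝ), Fin N → ℂ)) (ε : ℝ) (hε : 0 < ε) :
    ∃ (M : ℕ) (Q : Fin N → Polynomial ℂ), ∀ t : AddCircle (1 : ℝ),
      ‖φ t - fun i => ((AddCircle.toCircle t : ℂ) ^ M)⁻¹ *
        (Q i).eval (AddCircle.toCircle t : ℂ)‖ < ε := by
  have hfact : Fact (0 < (1 : ℝ)) := ⟨one_pos⟩
  have h : ∀ i, ∃ M₀ : ℕ, ∀ M ≥ M₀, ∃ Q : Polynomial ℂ, ∀ t : AddCircle (1 : ℝ),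
      ‖φ t i - ((AddCircle.toCircle t : ℂ) ^ M)⁻¹ * Q.eval (AddCircle.toCircle t : ℂ)‖ < ε := by
    intro i
    let φi : C(AddCircle (1 : ℝ), ℂ) := ⟨fun t => φ t i, by fun_prop⟩
    have hmem : φi ∈ (Submodule.span ℂ (Set.range (@fourier 1))).topologicalClosure := by
      rw [span_fourier_closure_eq_top]; trivial
    obtain ⟨p, hp, hd⟩ := Metric.mem_closure_iff.1 hmem ε hε
    obtain ⟨M₀, hM⟩ := trig_span p hp
    refine ⟨M₀, fun M h => ?_⟩
    obtain ⟨Q, hQ⟩ := hM M h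
    refine ⟨Q, fun t => ?_⟩
    rw [← hQ, ← dist_eq_norm]
    exact (ContinuousMap.dist_apply_le_dist t).trans_lt hd
  choose M₀ hM using h
  choose Q hQ using fun i => hM i (∑ j, M₀ j)
    (Finset.single_le_sum (f := M₀) (fun _ _ => Nat.zero_le _) (Finset.mem_univ i))
  refine ⟨∑ j, M₀ j, Q, fun t => ?_⟩
  rw [pi_norm_lt_iff hε]
  exact fun i => hQ i t

/-- The punctured complement of the affine cone. -/
def goodSet (n : ℕ) (S : Set (MvPolynomial (Fin (n + 1)) ℂ)) : Set (Fin (n + 1) → ℂ) :=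
  {x | x ≠ 0 ∧ ∃ p ∈ S, MvPolynomial.eval x p ≠ 0}

lemma isOpen_goodSet (n : ℕ) (S : Set (MvPolynomial (Fin (n + 1)) ℂ)) : IsOpen (goodSet n S) := by
  have : goodSet n S = {x | x ≠ 0} ∩ ⋃ p ∈ S, {x | MvPolynomial.eval x p ≠ 0} := by
    ext x; simp [goodSet]
  rw [this]
  refine IsOpen.inter isOpen_ne (isOpen_biUnion fun p _ => ?_)
  exact isOpen_ne_fun (MvPolynomial.continuous_eval p) continuous_const

lemma exists_perturbation (n : ℕ) (hn : 1 ≤ n) (S : Set (MvPolynomial (Fin (n + 1)) ℂ))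
    (hdim : ringKrullDim (MvPolynomial (Fin (n + 1)) ℂ ⧸ Ideal.span S) ≤
      ((n - 1 : ℕ) : WithBot ℕ∞))
    (Q : Fin (n + 1) → Polynomial ℂ) (ε : ℝ) (hε : 0 < ε) :
    ∃ v : Fin (n + 1) → ℂ, ‖v‖ < ε ∧ ∀ w : ℂ, (fun i => (Q i).eval w + v i) ∈ goodSet n S := by
  obtain ⟨g1, hg1, h1⟩ := exists_avoiding_polynomial n hn _ hdim Q
  obtain ⟨g2, hg2, h2⟩ := exists_avoiding_polynomial n hn
    (RingHom.ker (MvPolynomial.eval (0 : Fin (n + 1) → ℂ)))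
    (by rw [dim_origin]; exact_mod_cast Nat.zero_le _) Q
  obtain ⟨v, hv, hv'⟩ := small_nonvanishing (g1 * g2) (mul_ne_zero hg1 hg2) ε hε
  rw [map_mul] at hv'
  refine ⟨v, hv, fun w => ⟨fun h => ?_, ?_⟩⟩
  · apply right_ne_zero_of_mul hv'
    have := h2 0 (fun p hp => hp) w
    rw [← h] at this
    simpa using this
  · by_contra hcon
    push Not at hcon
    apply left_ne_zero_of_mul hv'
    have := h1 (fun i => (Q i).eval w + v i) (fun p hp => by
      have hle : Ideal.span S ≤ RingHom.ker (MvPolynomial.eval fun i => (Q i).eval w + v i) :=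
        Ideal.span_le.2 fun p hp => hcon p hp
      exact hle hp) w
    simpa using this

lemma eval_smul_of_isHomogeneous {N d : ℕ} {p : MvPolynomial (Fin N) ℂ} (hp : p.IsHomogeneous d)
    (c : ℂ) (x : Fin N → ℂ) :
    MvPolynomial.eval (c • x) p = c ^ d * MvPolynomial.eval x p := by
  rw [MvPolynomial.eval_eq, MvPolynomial.eval_eq, Finset.mul_sum]
  refine Finset.sum_congr rfl fun m hm => ?_
  have hd : ∑ i ∈ m.support, m i = d := by
    have := hp (MvPolynomial.mem_support_iff.1 hm)
    rw [← this, Finsupp.weight_apply, Finsupp.sum]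
    simp
  simp only [Pi.smul_apply, smul_eq_mul, mul_pow, Finset.prod_mul_distrib,
    Finset.prod_pow_eq_pow_sum, hd]
  ring

lemma notMem_iff_of_isRep {n : ℕ} {S : Set (MvPolynomial (Fin (n + 1)) ℂ)}
    (hhom : ∀ p ∈ S, ∃ d : ℕ, MvPolynomial.IsHomogeneous p d) {V : Set (ProjSpace n)}
    (hV : V = {z : ProjSpace n | ∀ x : {v : Fin (n + 1) → ℂ // v ≠ 0},
      Quot.mk (projRel n) x = z → ∀ p ∈ S, MvPolynomial.eval (x : Fin (n + 1) → ℂ) p = 0})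
    {x : Fin (n + 1) → ℂ} {z : ProjSpace n} (hx : IsRep x z) :
    z ∈ Vᶜ ↔ x ∈ goodSet n S := by
  constructor
  · intro hz
    refine ⟨hx.1, ?_⟩
    rw [Set.mem_compl_iff, hV, Set.mem_ofPred_eq] at hz
    push Not at hz
    obtain ⟨y, hy, p, hp, hne⟩ := hz
    refine ⟨p, hp, fun h0 => hne ?_⟩
    obtain ⟨c, hc, h⟩ := hx.exists_smul (y := y.1) ⟨y.2, hy⟩
    obtain ⟨d, hd⟩ := hhom p hp
    rw [h, eval_smul_of_isHomogeneous hd, h0, mul_zero]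
  · rintro ⟨h0, p, hp, hne⟩ hz
    rw [hV] at hz
    obtain ⟨h1, h2⟩ := hx
    exact hne (hz ⟨x, h0⟩ h2 p hp)

lemma null_of_perturbation {N : ℕ} {U : Set (Fin N → ℂ)} (hU : IsOpen U) {X : Type*}
    [TopologicalSpace X] (G : C(U, X))
    (hG : ∀ (x y : U) (c : ℂ), c ≠ 0 → y.1 = c • x.1 → G y = G x)
    (hpert : ∀ (Q : Fin N → Polynomial ℂ) (ε : ℝ), 0 < ε →
      ∃ v : Fin N → ℂ, ‖v‖ < ε ∧ ∀ w : ℂ, (fun i => (Q i).eval w + v i) ∈ U)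
    (Φ : C(AddCircle (1 : ℝ), U)) :
    ∃ c : X, (G.comp Φ).Homotopic (ContinuousMap.const _ c) := by
  have hfact : Fact (0 < (1 : ℝ)) := ⟨one_pos⟩
  let φ : C(AddCircle (1 : ℝ), Fin N → ℂ) := ⟨fun t => (Φ t).1, by fun_prop⟩
  obtain ⟨ε, hε, hsub⟩ := (isCompact_range φ.continuous).exists_thickening_subset_open hU
    (by rintro _ ⟨t, rfl⟩; exact (Φ t).2)
  have hball : ∀ t y, ‖φ t - y‖ < ε → y ∈ U := by
    intro t y hy
    refine hsub (Metric.mem_thickening_iff.2 ⟨φ t, ⟨t, rfl⟩, ?_⟩)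
    rwa [dist_comm, dist_eq_norm]
  obtain ⟨M, Q, hQ⟩ := trig_approx φ (ε / 2) (half_pos hε)
  obtain ⟨v, hv, hvU⟩ := hpert Q (ε / 2) (half_pos hε)
  let e : AddCircle (1 : ℝ) → ℂ := fun t => (AddCircle.toCircle t : ℂ)
  have he : Continuous e := continuous_subtype_val.comp AddCircle.continuous_toCircle
  have he0 : ∀ t, e t ≠ 0 := fun t => Circle.coe_ne_zero _
  have hen : ∀ t, ‖(e t ^ M)⁻¹‖ = 1 := fun t => by
    rw [norm_inv, norm_pow, Circle.norm_coe, one_pow, inv_one]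
  let q : ℂ → Fin N → ℂ := fun w i => (Q i).eval w + v i
  have hq : Continuous q := by
    refine continuous_pi fun i => ?_
    exact ((Q i).continuous).add continuous_const
  let h : AddCircle (1 : ℝ) → Fin N → ℂ := fun t => (e t ^ M)⁻¹ • q (e t)
  have hh : Continuous h := by
    have h1 := (he.pow M).inv₀ fun t => pow_ne_zero _ (he0 t)
    exact h1.smul (hq.comp he)
  have hclose : ∀ t, ‖φ t - h t‖ < ε := by
    intro t
    have h1 : h t = (fun i => (e t ^ M)⁻¹ * (Q i).eval (e t)) + (e t ^ M)⁻¹ • v := by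
      funext i; simp [h, q, mul_add]
    rw [h1, ← sub_sub]
    refine (norm_sub_le _ _).trans_lt ?_
    rw [norm_smul, hen, one_mul]
    have := hQ t
    linarith
  have hseg : ∀ (s : I) t, φ t + (s : ℝ) • (h t - φ t) ∈ U := by
    intro s t
    refine hball t _ ?_
    rw [sub_add_cancel_left, norm_neg, norm_smul, ← norm_neg (h t - φ t), neg_sub]
    refine lt_of_le_of_lt ?_ (hclose t)
    refine mul_le_of_le_one_left (norm_nonneg _) ?_
    rw [Real.norm_of_nonneg s.2.1]; exact s.2.2
  have hhU : ∀ t, h t ∈ U := fun t => hball t _ (hclose t)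
  let Ψ : C(AddCircle (1 : ℝ), U) := ⟨fun t => ⟨h t, hhU t⟩, by fun_prop⟩
  let Θ : C(AddCircle (1 : ℝ), U) := ⟨fun t => ⟨q (e t), hvU _⟩, by fun_prop⟩
  have H1 : Φ.Homotopic Ψ := by
    refine ⟨⟨⟨fun p => ⟨φ p.2 + (p.1 : ℝ) • (h p.2 - φ p.2), hseg p.1 p.2⟩, by fun_prop⟩, ?_, ?_⟩⟩
    · intro t; ext1; simp [φ]
    · intro t; ext1; simp [φ, Ψ]
  have H2 : Θ.Homotopic (ContinuousMap.const _ ⟨q 0, hvU 0⟩) := by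
    refine ⟨⟨⟨fun p => ⟨q ((1 - ((p.1 : ℝ) : ℂ)) * e p.2), hvU _⟩, by fun_prop⟩, ?_, ?_⟩⟩
    · intro t; ext1; simp [Θ]
    · intro t; ext1; simp
  have H3 : G.comp Ψ = G.comp Θ := by
    ext t
    exact hG (Θ t) (Ψ t) _ (inv_ne_zero (pow_ne_zero M (he0 t))) rfl
  refine ⟨G ⟨q 0, hvU 0⟩, ?_⟩
  have K1 := (ContinuousMap.Homotopic.refl G).comp H1
  have K2 := (ContinuousMap.Homotopic.refl G).comp H2
  rw [H3] at K1
  exact K1.trans K2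

lemma isPathConnected_of_perturbation {N : ℕ} {U : Set (Fin N → ℂ)} (hU : IsOpen U)
    (hpert : ∀ (Q : Fin N → Polynomial ℂ) (ε : ℝ), 0 < ε →
      ∃ v : Fin N → ℂ, ‖v‖ < ε ∧ ∀ w : ℂ, (fun i => (Q i).eval w + v i) ∈ U) :
    IsPathConnected U := by
  rw [isPathConnected_iff]
  refine ⟨?_, fun a ha b hb => ?_⟩
  · obtain ⟨v, -, h⟩ := hpert 0 1 one_pos
    exact ⟨_, h 0⟩
  · obtain ⟨ε1, h1, hb1⟩ := Metric.isOpen_iff.1 hU a ha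
    obtain ⟨ε2, h2, hb2⟩ := Metric.isOpen_iff.1 hU b hb
    obtain ⟨v, hv, hvU⟩ := hpert (fun i => Polynomial.C (a i) +
      Polynomial.X * Polynomial.C (b i - a i)) (min ε1 ε2) (lt_min h1 h2)
    have j1 : JoinedIn U a (a + v) := by
      refine JoinedIn.of_segment_subset ?_
      refine ((convex_ball a ε1).segment_subset (Metric.mem_ball_self h1) ?_).trans hb1
      simpa using hv.trans_le (min_le_left _ _)
    have j2 : JoinedIn U b (b + v) := by
      refine JoinedIn.of_segment_subset ?_
      refine ((convex_ball b ε2).segment_subset (Metric.mem_ball_self h2) ?_).trans hb2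
      simpa using hv.trans_le (min_le_right _ _)
    have j3 : JoinedIn U (a + v) (b + v) := by
      refine JoinedIn.of_segment_subset ?_
      rw [segment_eq_image']
      rintro _ ⟨s, -, rfl⟩
      convert hvU (s : ℂ) using 1
      funext i
      simp
      ring
    exact (j1.trans j3).trans j2.symm

/-- If `S` is a set of homogeneous polynomials in `ℂ[x₀,…,xₙ]` generating
an ideal `I` with `dim ℂ[x₀,…,xₙ]/I ≤ n - 1`, then the complement in `ℙⁿ(ℂ)` of the common
projective zero locus of `S` is simply connected. -/
theorem complement_of_small_projective_zero_locus_simplyConnected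
    (n : ℕ) (hn : 1 ≤ n) (S : Set (MvPolynomial (Fin (n + 1)) ℂ))
    (hhom : ∀ p ∈ S, ∃ d : ℕ, MvPolynomial.IsHomogeneous p d)
    (hdim : ringKrullDim (MvPolynomial (Fin (n + 1)) ℂ ⧸ Ideal.span S) ≤
      ((n - 1 : ℕ) : WithBot (WithTop ℕ)))
    (V : Set (ProjSpace n))
    (hV : V = {z : ProjSpace n | ∀ x : {v : Fin (n + 1) → ℂ // v ≠ 0},
      Quot.mk (projRel n) x = z → ∀ p ∈ S, MvPolynomial.eval (x : Fin (n + 1) → ℂ) p = 0}) :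
    SimplyConnectedSpace ↥Vᶜ := by
  have hdim' : ringKrullDim (MvPolynomial (Fin (n + 1)) ℂ ⧸ Ideal.span S) ≤
      ((n - 1 : ℕ) : WithBot ℕ∞) := hdim
  have hpert := exists_perturbation n hn S hdim'
  have hU := isOpen_goodSet n S
  let G : C(goodSet n S, ↥Vᶜ) :=
    ⟨fun x => ⟨projMk n ⟨x.1, x.2.1⟩, (notMem_iff_of_isRep hhom hV ⟨x.2.1, rfl⟩).2 x.2⟩, by
      refine Continuous.subtype_mk ((isQuotientMap_mk n).continuous.comp ?_) _
      fun_prop⟩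
  have hGrep : ∀ (x : goodSet n S) (z : ↥Vᶜ), IsRep x.1 z.1 → G x = z := by
    rintro x z ⟨h, hz⟩
    exact Subtype.ext hz
  rw [simply_connected_iff_loops_nullhomotopic]
  constructor
  · have hpc := isPathConnected_of_perturbation hU hpert
    have : PathConnectedSpace (goodSet n S) := isPathConnected_iff_pathConnectedSpace.1 hpc
    refine Function.Surjective.pathConnectedSpace (f := G) ?_ G.continuous
    intro z
    obtain ⟨x, hx⟩ : ∃ x, Quot.mk (projRel n) x = z.1 := Quot.exists_rep z.1
    have hr : IsRep x.1 z.1 := ⟨x.2, hx⟩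
    exact ⟨⟨x.1, (notMem_iff_of_isRep hhom hV hr).1 z.2⟩, hGrep _ _ hr⟩
  · intro x γ
    obtain ⟨φ, hφ⟩ := exists_loop_lift (n := n) ⟨fun t => (γ t).1, by fun_prop⟩ (by simp)
    have hφ' : ∀ t : I, IsRep (φ ((t : ℝ) : AddCircle (1 : ℝ))) (γ t).1 := hφ
    have hφU : ∀ t, φ t ∈ goodSet n S := by
      intro t
      have hfact : Fact (0 < (1 : ℝ)) := ⟨one_pos⟩
      have hs := (AddCircle.equivIco 1 0 t).2
      have ht : (((AddCircle.equivIco 1 0 t : ℝ)) : AddCircle (1 : ℝ)) = t :=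
        AddCircle.coe_equivIco
      have := hφ' ⟨(AddCircle.equivIco 1 0 t : ℝ), hs.1, by simpa using hs.2.le⟩
      rw [ht] at this
      exact (notMem_iff_of_isRep hhom hV this).1 (γ _).2
    obtain ⟨c, ⟨H⟩⟩ := null_of_perturbation hU G (by
      intro a b c hc hab
      refine hGrep _ _ ?_
      rw [hab]
      exact IsRep.smul ⟨a.2.1, rfl⟩ hc) hpert ⟨fun t => ⟨φ t, hφU t⟩, by fun_prop⟩
    let j : C(I, AddCircle (1 : ℝ)) :=
      ⟨fun t => ((t : ℝ) : AddCircle (1 : ℝ)),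
        (AddCircle.continuous_mk' 1).comp continuous_subtype_val⟩
    refine path_homotopic_refl_of_free (c := c) γ
      ⟨fun p => H (p.1, j p.2), by fun_prop⟩ ?_ ?_ ?_
    · intro t
      simp only [ContinuousMap.coe_mk, ContinuousMap.Homotopy.apply_zero]
      exact hGrep _ _ (hφ' t)
    · intro t
      simp
    · intro s
      have : j 0 = j 1 := by
        change (((0 : I) : ℝ) : AddCircle (1 : ℝ)) = (((1 : I) : ℝ) : AddCircle (1 : ℝ))
        exact (AddCircle.coe_period (1 : ℝ)).symm
      simp [this]
end

section
/- Let n ≥ 1 and let a₀,…,aₙ be positive integers with gcd(a₀,…,aₙ) = 1. Let U ⊆ ℙ(a₀,…,aₙ) be the set of classes [x₀ : ⋯ : xₙ] such that at most one of the coordinates x₀,…,xₙ is zero (this condition is independent of the chosen representative). Then U, with the subspace topology, is simply connected. -/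
/-- The weighted scalar equivalence on `ℂ^{n+1} \ {0}` with weights `a`. -/
def wprojRel (n : ℕ) (a : Fin (n + 1) → ℕ) (x y : {v : Fin (n + 1) → ℂ // v ≠ 0}) : Prop :=
  ∃ t : ℂ, t ≠ 0 ∧ ∀ i, (y : Fin (n + 1) → ℂ) i = t ^ (a i) * (x : Fin (n + 1) → ℂ) i

/-- The weighted projective space `ℙ(a₀,…,aₙ)` as a quotient topological space. -/
def WProj (n : ℕ) (a : Fin (n + 1) → ℕ) : Type :=
  Quot (wprojRel n a)

instance (n : ℕ) (a : Fin (n + 1) → ℕ) : TopologicalSpace (WProj n a) :=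
  inferInstanceAs (TopologicalSpace (Quot (wprojRel n a)))


open Path.Homotopic in
/-- Two paths which are images of paths with common endpoints in a simply connected space
are homotopic. -/
theorem lift_homotopic {E B : Type*} [TopologicalSpace E] [TopologicalSpace B]
    [SimplyConnectedSpace E] (f : E → B) (hf : Continuous f) {x y : B} {u v : E}
    (p p' : Path x y) (d d' : Path u v) (hp : ∀ t, p t = f (d t)) (hp' : ∀ t, p' t = f (d' t)) :
    p.Homotopic p' := by
  have h := SimplyConnectedSpace.paths_homotopic d d'
  have hx : x = f u := by simpa using hp 0
  have hy : y = f v := by simpa using hp 1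
  subst hx hy
  have e1 : p = d.map hf := by ext t; simp [hp]
  have e2 : p' = d'.map hf := by ext t; simp [hp']
  rw [e1, e2]
  exact h.map ⟨f, hf⟩

section criterion
variable {B : Type*} [TopologicalSpace B] {b : B} (Can : ∀ x : B, Path b x → Prop)

/-- A path carries canonical classes to canonical classes. -/
def GoodPath {x y : B} (g : Path x y) : Prop :=
  ∀ (p : Path b x) (p' : Path b y), Can x p → Can y p' → (p.trans g).Homotopic p'

variable (hex : ∀ x, ∃ p, Can x p)
include hex

theorem GoodPath.trans' {x y z : B} {g : Path x y} {g' : Path y z} (h : GoodPath Can g)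
    (h' : GoodPath Can g') : GoodPath Can (g.trans g') := by
  intro p p' hp hp'
  obtain ⟨r, hr⟩ := hex y
  have h1 := h p r hp hr
  have h2 := h' r p' hr hp'
  rw [← Path.Homotopic.Quotient.eq] at *
  simp only [Path.Homotopic.Quotient.mk_trans] at *
  rw [← h2, ← h1]; simp

omit hex in
theorem GoodPath.congr' {x y : B} {g g' : Path x y} (h : GoodPath Can g)
    (hg : g.Homotopic g') : GoodPath Can g' := by
  intro p p' hp hp'
  exact ((Path.Homotopic.refl p).hcomp hg.symm).trans (h p p' hp hp')

theorem GoodPath.cancel {x y z w : B} {g : Path x y} {s : Path y z} {r : Path x w} {g' : Path w z}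
    (hs : GoodPath Can s) (hr : GoodPath Can r) (hg' : GoodPath Can g')
    (H : (r.trans g').Homotopic (g.trans s)) : GoodPath Can g := by
  intro p p' hp hp'
  obtain ⟨c, hc⟩ := hex z
  have h1 := GoodPath.trans' Can hex hr hg' p c hp hc
  have h2 := hs p' c hp' hc
  rw [← Path.Homotopic.Quotient.eq] at *
  simp only [Path.Homotopic.Quotient.mk_trans] at *
  rw [H, ← h2] at h1
  have h3 := congrArg (fun q => Path.Homotopic.Quotient.trans q
    (Path.Homotopic.Quotient.symm (Path.Homotopic.Quotient.mk s))) h1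
  simpa using h3

theorem simplyConnected_of_canonical
    (huniq : ∀ x p p', Can x p → Can x p' → p.Homotopic p')
    (hloc : ∀ x : B, ∃ V ∈ nhds x, ∀ (y z : B) (g : Path y z), (∀ t, g t ∈ V) →
      GoodPath Can g) : SimplyConnectedSpace B := by
  have hgood : ∀ (x y : B) (g : Path x y), GoodPath Can g := by
    intro x y g
    choose V hV hVg using hloc
    obtain ⟨t, t0, tm, ⟨N, hN⟩, ht⟩ := exists_monotone_Icc_subset_open_cover_unitInterval
      (c := fun z : B => g ⁻¹' (interior (V z))) (fun z => isOpen_interior.preimage g.continuous)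
      (fun s _ => Set.mem_iUnion.2 ⟨g s, mem_interior_iff_mem_nhds.2 (hV _)⟩)
    have key : ∀ m, GoodPath Can (g.subpath (t 0) (t m)) := by
      intro m
      induction m with
      | zero =>
        rw [Path.subpath_self]
        intro p p' hp hp'
        have := huniq _ p p' hp hp'
        rw [← Path.Homotopic.Quotient.eq] at *
        simp only [Path.Homotopic.Quotient.mk_trans] at *
        rw [← this]; simp
      | succ m ih =>
        refine GoodPath.congr' Can (GoodPath.trans' Can hex ih (g' := g.subpath (t m) (t (m+1))) ?_)
          ⟨Path.Homotopy.subpathTransSubpath g _ _ _⟩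
        obtain ⟨z, hz⟩ := ht m
        refine hVg z _ _ _ fun s => ?_
        have : g.subpath (t m) (t (m+1)) s ∈ Set.range (g.subpath (t m) (t (m+1))) := ⟨s, rfl⟩
        rw [Path.range_subpath_of_le _ _ _ (tm (Nat.le_succ m))] at this
        obtain ⟨r, hr, hr'⟩ := this
        rw [← hr']
        exact interior_subset (hz hr)
    have := key N
    rw [t0, hN N le_rfl, Path.subpath_zero_one] at this
    have gen : ∀ (x' y' : B) (hx : x' = x) (hy : y' = y), GoodPath Can (g.cast hx hy) →
        GoodPath Can g := by
      rintro x' y' rfl rfl h; exact h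
    exact gen _ _ _ _ this
  rw [simply_connected_iff_paths_homotopic']
  refine ⟨⟨⟨b⟩, fun x y => ?_⟩, fun {x y} p p' => ?_⟩
  · obtain ⟨p, _⟩ := hex x
    obtain ⟨p', _⟩ := hex y
    exact ⟨p.symm.trans p'⟩
  · obtain ⟨c, hc⟩ := hex x
    obtain ⟨c', hc'⟩ := hex y
    have h1 := hgood x y p c c' hc hc'
    have h2 := (hgood x y p' c c' hc hc').symm
    have h3 := h1.trans h2
    rw [← Path.Homotopic.Quotient.eq] at *
    simp only [Path.Homotopic.Quotient.mk_trans] at *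
    have h4 := congrArg (fun q => Path.Homotopic.Quotient.trans
      (Path.Homotopic.Quotient.symm (Path.Homotopic.Quotient.mk c)) q) h3
    simpa [← Path.Homotopic.Quotient.trans_assoc] using h4

end criterion

/-- The commuting square given by a map from the unit square. -/
theorem square_homotopic {B : Type*} [TopologicalSpace B] (K : unitInterval × unitInterval → B)
    (hK : Continuous K) {x y z w : B} (g : Path x y) (s : Path y z) (r : Path x w) (g' : Path w z)
    (hg : ∀ t, g t = K (t, 0)) (hs : ∀ t, s t = K (1, t)) (hr : ∀ t, r t = K (0, t))
    (hg' : ∀ t, g' t = K (t, 1)) : (r.trans g').Homotopic (g.trans s) := by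
  let i01 : Path (0 : unitInterval) 1 := ⟨⟨id, continuous_id⟩, rfl, rfl⟩
  have : ContractibleSpace unitInterval := by
    exact (convex_Icc (0:ℝ) 1).contractibleSpace ⟨0, by simp⟩
  refine lift_homotopic K hK _ _
    (((Path.refl (0 : unitInterval)).prod i01).trans (i01.prod (Path.refl 1)))
    ((i01.prod (Path.refl 0)).trans ((Path.refl 1).prod i01)) ?_ ?_
  · intro t
    simp only [Path.trans_apply]
    split_ifs
    · simp [hr, i01]
    · simp [hg', i01]
  · intro t
    simp only [Path.trans_apply]
    split_ifs
    · simp [hg, i01]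
    · simp [hs, i01]

/-- Vectors with at most one zero coordinate. -/
abbrev AMZ (n : ℕ) : Type :=
  {v : Fin (n + 1) → ℂ // ∀ i j : Fin (n + 1), v i = 0 → v j = 0 → i = j}

/-- The chart `ℂ × ℂ^n → AMZ`, exponential in all coordinates but the `i`-th one. -/
noncomputable def chartQ {n : ℕ} (i : Fin (n + 1)) (w : Fin (n + 1) → ℂ) : AMZ n :=
  ⟨fun k => if k = i then w k else Complex.exp (w k), by
    intro j k hj hk
    have : ∀ l, (if l = i then w l else Complex.exp (w l)) = 0 → l = i := by
      intro l hl
      by_contra h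
      simp [h] at hl
    rw [this j hj, this k hk]⟩

theorem chartQ_val {n : ℕ} (i : Fin (n + 1)) (w : Fin (n + 1) → ℂ) (k : Fin (n + 1)) :
    (chartQ i w).1 k = if k = i then w k else Complex.exp (w k) := rfl

theorem continuous_chartQ {n : ℕ} (i : Fin (n + 1)) : Continuous (chartQ (n := n) i) := by
  refine Continuous.subtype_mk (continuous_pi fun k => ?_) _
  split_ifs <;> fun_prop

/-- Base points of the charts. -/
noncomputable def baseE {n : ℕ} (i : Fin (n + 1)) : Fin (n + 1) → ℂ := Pi.single i 1

/-- The vector of ones. -/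
def oneX (n : ℕ) : AMZ n := ⟨fun _ => 1, fun _ _ h => absurd h one_ne_zero⟩

theorem chartQ_base {n : ℕ} (i : Fin (n + 1)) : chartQ i (baseE i) = oneX n := by
  ext k
  by_cases h : k = i
  · subst h; simp [chartQ, baseE, oneX]
  · simp [chartQ, baseE, oneX, h]

/-- The straight path. -/
noncomputable def linePath {m : ℕ} (u v : Fin m → ℂ) : Path u v where
  toFun t := fun k => u k + ((t : ℝ) : ℂ) * (v k - u k)
  continuous_toFun := by fun_prop
  source' := by ext; simp
  target' := by ext; simp

theorem linePath_apply {m : ℕ} (u v : Fin m → ℂ) (t : unitInterval) (k : Fin m) :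
    linePath u v t k = u k + ((t : ℝ) : ℂ) * (v k - u k) := rfl

section setup
variable {n : ℕ} {a : Fin (n + 1) → ℕ} {B : Type*} [TopologicalSpace B] {q : AMZ n → B}

/-- The path `p` is the image of a path in chart `i` from the base point to `w`. -/
def RepPath (q : AMZ n → B) (i : Fin (n + 1)) (w : Fin (n + 1) → ℂ) {x : B}
    (p : Path (q (oneX n)) x) : Prop :=
  ∃ d : Path (baseE i) w, ∀ t, p t = q (chartQ i (d t))

/-- Canonical paths. -/
def CanPath (q : AMZ n → B) (x : B) (p : Path (q (oneX n)) x) : Prop :=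
  ∃ i w, RepPath q i w p

theorem RepPath.eq {i : Fin (n + 1)} {w : Fin (n + 1) → ℂ} {x : B}
    {p : Path (q (oneX n)) x} (h : RepPath q i w p) : q (chartQ i w) = x := by
  obtain ⟨d, hd⟩ := h
  simpa using (hd 1).symm

theorem RepPath.exists (hc : Continuous q) (i : Fin (n + 1)) {u w : Fin (n + 1) → ℂ}
    (hu : u = baseE i) (d : Path u w) {x : B} (hx : q (chartQ i w) = x) :
    ∃ p : Path (q (oneX n)) x, RepPath q i w p ∧ ∀ t, p t = q (chartQ i (d t)) := by
  subst hu
  have hcc : Continuous fun t => q (chartQ i (d t)) :=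
    hc.comp ((continuous_chartQ i).comp d.continuous)
  refine ⟨⟨⟨fun t => q (chartQ i (d t)), hcc⟩, by simp [chartQ_base], by simp [hx]⟩, ⟨d, ?_⟩, ?_⟩
  · intro t; rfl
  · intro t; rfl

theorem RepPath.homotopic (hc : Continuous q) {i : Fin (n + 1)} {w : Fin (n + 1) → ℂ} {x : B}
    {p p' : Path (q (oneX n)) x} (h : RepPath q i w p) (h' : RepPath q i w p') :
    p.Homotopic p' := by
  obtain ⟨d, hd⟩ := h
  obtain ⟨d', hd'⟩ := h'
  exact lift_homotopic (fun e => q (chartQ i e)) (hc.comp (continuous_chartQ i)) p p' d d' hd hd'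

/-- Translation of one exponential coordinate by a period. -/
theorem RepPath.shift (hc : Continuous q) {i : Fin (n + 1)} {w : Fin (n + 1) → ℂ} {x : B}
    {p : Path (q (oneX n)) x} (h : RepPath q i w p) {j : Fin (n + 1)} (hj : j ≠ i) (m : ℤ) :
    ∃ p' : Path (q (oneX n)) x,
      RepPath q i (w + Pi.single j (m * (2 * Real.pi * Complex.I))) p' ∧ p.Homotopic p' := by
  obtain ⟨d, hd⟩ := h
  set c : ℂ := m * (2 * Real.pi * Complex.I) with hcdef
  have hexp : Complex.exp c = 1 := Complex.exp_int_mul_two_pi_mul_I m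
  set v : Fin (n + 1) → ℂ := Pi.single j c with hv
  have hshift : ∀ e, chartQ i (e + v) = chartQ i e := by
    intro e
    ext k
    simp only [chartQ_val]
    split_ifs with hk
    · subst hk; simp [hv, hj.symm]
    · by_cases hkj : k = j
      · subst hkj; simp [hv, Complex.exp_add, hexp]
      · simp [hv, hkj]
  -- the loop
  let L : Path (baseE i) (baseE i + v) := linePath _ _
  obtain ⟨l, hl, hl'⟩ := RepPath.exists hc i rfl L (x := q (oneX n))
    (by rw [hshift, chartQ_base])
  -- the same loop in chart j
  have hnull : l.Homotopic (Path.refl _) := by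
    let D : Path (baseE (n := n) j) (baseE j) :=
      { toFun := fun t => Pi.single j (Complex.exp (((t : ℝ) : ℂ) * c))
        continuous_toFun := by
          refine continuous_pi fun k => ?_
          by_cases hk : k = j
          · subst hk; simp only [Pi.single_eq_same]; fun_prop
          · simp only [Pi.single_eq_of_ne hk]; fun_prop
        source' := by simp [baseE]
        target' := by simp [baseE, hexp] }
    refine lift_homotopic (fun e => q (chartQ j e)) (hc.comp (continuous_chartQ j)) _ _ D
      (Path.refl _) ?_ ?_
    · intro t
      rw [hl']
      congr 1
      ext k
      have hD : D t k = (Pi.single j (Complex.exp (((t : ℝ) : ℂ) * c)) : Fin (n + 1) → ℂ) k := rfl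
      have hL : L t k = baseE i k + ((t : ℝ) : ℂ) * ((baseE i + v) k - baseE i k) := rfl
      rw [chartQ_val, chartQ_val, hD, hL, hv]
      simp only [baseE, Pi.add_apply]
      by_cases hk : k = j
      · subst hk; simp [hj]
      · by_cases hki : k = i
        · subst hki; simp [hk]
        · simp [hk, hki]
    · intro t
      simp [chartQ_base]
  have hd2 : ∀ t, p t = q (chartQ i ((d.map (continuous_add_const v)) t)) := by
    intro t
    simp [hd, hshift]
  refine ⟨l.trans p, ⟨L.trans (d.map (continuous_add_const v)), ?_⟩, ?_⟩
  · intro t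
    simp only [Path.trans_apply]
    split_ifs
    · rw [hl']
    · rw [hd2]
  · rw [← Path.Homotopic.Quotient.eq] at *
    simp [Path.Homotopic.Quotient.mk_trans, hnull]

theorem RepPath.shifts (hc : Continuous q) {i : Fin (n + 1)} {w w' : Fin (n + 1) → ℂ} {x : B}
    {p : Path (q (oneX n)) x} (h : RepPath q i w p) (hi : w i = w' i)
    (hw : ∀ k, k ≠ i → Complex.exp (w' k) = Complex.exp (w k)) :
    ∃ p' : Path (q (oneX n)) x, RepPath q i w' p' ∧ p.Homotopic p' := by
  have key : ∀ S : Finset (Fin (n + 1)), ∃ p' : Path (q (oneX n)) x,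
      RepPath q i (fun k => if k ∈ S then w' k else w k) p' ∧ p.Homotopic p' := by
    intro S
    induction S using Finset.induction_on with
    | empty => exact ⟨p, by simpa using h, Path.Homotopic.refl _⟩
    | insert j S hjS ih =>
      obtain ⟨p', hp', hh⟩ := ih
      by_cases hj : j = i
      · subst hj
        refine ⟨p', ?_, hh⟩
        convert hp' using 2 with k
        by_cases hk : k = j
        · subst hk; simp [hi]
        · simp [hk]
      · obtain ⟨m, hm⟩ := Complex.exp_eq_exp_iff_exists_int.1 (hw j hj)
        obtain ⟨p2, hp2, hh2⟩ := hp'.shift hc hj m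
        refine ⟨p2, ?_, hh.trans hh2⟩
        convert hp2 using 2 with k
        by_cases hk : k = j
        · subst hk; simp [hjS, hm]
        · simp [hk]
  simpa using key Finset.univ

/-- Scaling by `exp s`. -/
theorem RepPath.scale (hc : Continuous q)
    (hrel : ∀ x y, q x = q y ↔ ∃ t : ℂ, t ≠ 0 ∧ ∀ i, y.1 i = t ^ (a i) * x.1 i)
    {i : Fin (n + 1)} {w : Fin (n + 1) → ℂ} {x : B}
    {p : Path (q (oneX n)) x} (h : RepPath q i w p) (s : ℂ) :
    ∃ p' : Path (q (oneX n)) x,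
      RepPath q i (fun k => if k = i then w k * Complex.exp (s * a k) else w k + s * a k) p' ∧
        p.Homotopic p' := by
  have hx := h.eq
  obtain ⟨d, hd⟩ := h
  let D : Path w (fun k => if k = i then w k * Complex.exp (s * a k) else w k + s * a k) :=
    { toFun := fun t k => if k = i then w k * Complex.exp (((t : ℝ) : ℂ) * s * a k)
        else w k + ((t : ℝ) : ℂ) * s * a k
      continuous_toFun := by
        refine continuous_pi fun k => ?_
        split_ifs <;> fun_prop
      source' := by ext k; simp
      target' := by ext k; simp }
  refine ⟨p.trans (Path.refl _), ⟨d.trans D, ?_⟩, ?_⟩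
  · intro t
    simp only [Path.trans_apply]
    split_ifs
    · rw [hd]
    · rw [Path.refl_apply, ← hx, hrel]
      generalize (⟨2 * (t : ℝ) - 1, _⟩ : unitInterval) = r
      refine ⟨Complex.exp ((r : ℝ) * s), Complex.exp_ne_zero _, fun k => ?_⟩
      have hD : D r k = if k = i then w k * Complex.exp (((r : ℝ) : ℂ) * s * a k)
        else w k + ((r : ℝ) : ℂ) * s * a k := rfl
      rw [chartQ_val, chartQ_val, hD, ← Complex.exp_nat_mul]
      split_ifs
      · rw [mul_comm]; ring_nf
      · rw [← Complex.exp_add]; ring_nf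
  · rw [← Path.Homotopic.Quotient.eq] at *
    simp [Path.Homotopic.Quotient.mk_trans]

/-- Change of chart. -/
theorem RepPath.change (hc : Continuous q)
    {i j : Fin (n + 1)} (hij : i ≠ j) {w : Fin (n + 1) → ℂ} {x : B}
    {p : Path (q (oneX n)) x} (h : RepPath q i w p) (hw : w i ≠ 0) :
    ∃ (w' : Fin (n + 1) → ℂ) (p' : Path (q (oneX n)) x), RepPath q j w' p' ∧ p.Homotopic p' := by
  have hx := h.eq
  let u : Fin (n + 1) → ℂ := fun k => if k = i then Complex.log (w k) else w k
  let L : Path 0 u := linePath 0 u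
  have cont : ∀ l : Fin (n + 1), Continuous fun (e : Fin (n + 1) → ℂ) k =>
      if k = l then Complex.exp (e k) else e k := by
    intro l
    refine continuous_pi fun k => ?_
    split_ifs <;> fun_prop
  have hb : ∀ l : Fin (n + 1), (fun k => if k = l then Complex.exp ((0 : Fin (n + 1) → ℂ) k)
      else (0 : Fin (n + 1) → ℂ) k) = baseE l := by
    intro l
    ext k
    by_cases hk : k = l
    · subst hk; simp [baseE]
    · simp [baseE, hk]
  have hch : ∀ (l : Fin (n + 1)) (e : Fin (n + 1) → ℂ),
      (chartQ l (fun k => if k = l then Complex.exp (e k) else e k)).1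
        = fun k => Complex.exp (e k) := by
    intro l e
    ext k
    rw [chartQ_val]
    split_ifs <;> rfl
  have hch2 : ∀ (e : Fin (n + 1) → ℂ),
      (chartQ i (fun k => if k = i then Complex.exp (e k) else e k)) =
      (chartQ j (fun k => if k = j then Complex.exp (e k) else e k)) := by
    intro e
    apply Subtype.ext
    rw [hch, hch]
  have hu : (fun k => if k = i then Complex.exp (u k) else u k) = w := by
    ext k
    by_cases hk : k = i
    · subst hk; simp [u, Complex.exp_log hw]
    · simp [u, hk]
  obtain ⟨p1, hp1, hp1'⟩ := RepPath.exists hc i (hb i) (L.map (cont i)) (x := x)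
    (by rw [hu, hx])
  rw [hu] at hp1
  obtain ⟨p2, hp2, hp2'⟩ := RepPath.exists hc j (hb j) (L.map (cont j)) (x := x)
    (by rw [← hch2, hu, hx])
  refine ⟨_, p2, hp2, ?_⟩
  have : p2 = p1 := by
    ext t
    rw [hp1', hp2']
    simp only [Path.map_coe, Function.comp]
    rw [hch2]
  rw [this]
  exact h.homotopic hc hp1

theorem RepPath.unique_same (hc : Continuous q)
    (hrel : ∀ x y, q x = q y ↔ ∃ t : ℂ, t ≠ 0 ∧ ∀ i, y.1 i = t ^ (a i) * x.1 i)
    {i : Fin (n + 1)} {w w' : Fin (n + 1) → ℂ} {x : B}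
    {p p' : Path (q (oneX n)) x} (h : RepPath q i w p) (h' : RepPath q i w' p') :
    p.Homotopic p' := by
  obtain ⟨t, ht, htw⟩ := (hrel _ _).1 (h.eq.trans h'.eq.symm)
  have hts : t = Complex.exp (Complex.log t) := (Complex.exp_log ht).symm
  obtain ⟨p1, hp1, hh1⟩ := h.scale hc hrel (Complex.log t)
  have hpow : ∀ k, t ^ (a k) = Complex.exp (Complex.log t * a k) := by
    intro k
    conv_lhs => rw [hts]
    rw [← Complex.exp_nat_mul, mul_comm]
  obtain ⟨p2, hp2, hh2⟩ := hp1.shifts hc (w' := w')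
    (by
      have := htw i
      simp only [chartQ_val, if_true] at this ⊢
      rw [this, hpow, mul_comm])
    (by
      intro k hk
      have := htw k
      simp only [chartQ_val, hk, if_false] at this ⊢
      rw [this, hpow, ← Complex.exp_add, add_comm])
  exact (hh1.trans hh2).trans (hp2.homotopic hc h')

theorem CanPath.unique (hc : Continuous q)
    (hrel : ∀ x y, q x = q y ↔ ∃ t : ℂ, t ≠ 0 ∧ ∀ i, y.1 i = t ^ (a i) * x.1 i)
    (x : B) (p p' : Path (q (oneX n)) x) (h : CanPath q x p) (h' : CanPath q x p') :
    p.Homotopic p' := by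
  obtain ⟨i, w, h⟩ := h
  obtain ⟨j, w', h'⟩ := h'
  by_cases hij : i = j
  · subst hij
    exact h.unique_same hc hrel h'
  · have hw : w i ≠ 0 := by
      obtain ⟨t, ht, htw⟩ := (hrel _ _).1 (h.eq.trans h'.eq.symm)
      have := htw i
      simp only [chartQ_val, if_true, hij, if_false] at this
      intro h0
      rw [h0, mul_zero] at this
      exact Complex.exp_ne_zero _ this
    obtain ⟨w2, p2, hp2, hh⟩ := h.change hc hij hw
    exact hh.trans (hp2.unique_same hc hrel h')

theorem exists_chart_index (x : AMZ n) : ∃ i, ∀ k, k ≠ i → x.1 k ≠ 0 := by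
  by_cases h : ∃ i, x.1 i = 0
  · obtain ⟨i, hi⟩ := h
    exact ⟨i, fun k hk h0 => hk (x.2 k i h0 hi)⟩
  · push Not at h
    exact ⟨0, fun k _ => h k⟩

theorem exists_chart (x : AMZ n) (i : Fin (n + 1)) (h : ∀ k, k ≠ i → x.1 k ≠ 0) :
    chartQ i (fun k => if k = i then x.1 k else Complex.log (x.1 k)) = x := by
  ext k
  rw [chartQ_val]
  split_ifs with hk
  · rfl
  · exact Complex.exp_log (h k hk)

theorem CanPath.exists (hc : Continuous q) (hs : Function.Surjective q) (x : B) :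
    ∃ p, CanPath q x p := by
  obtain ⟨y, rfl⟩ := hs x
  obtain ⟨i, hi⟩ := exists_chart_index y
  obtain ⟨p, hp, _⟩ := RepPath.exists hc i rfl (linePath (baseE i) _)
    (congrArg q (exists_chart y i hi))
  exact ⟨p, i, _, hp⟩

theorem good_of_chart (hc : Continuous q)
    (hrel : ∀ x y, q x = q y ↔ ∃ t : ℂ, t ≠ 0 ∧ ∀ i, y.1 i = t ^ (a i) * x.1 i)
    (i : Fin (n + 1)) {x y : B} (g : Path x y) {u v : Fin (n + 1) → ℂ} (d : Path u v)
    (hg : ∀ t, g t = q (chartQ i (d t))) : GoodPath (CanPath q) g := by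
  intro p p' hp hp'
  have hx : q (chartQ i u) = x := by simpa using (hg 0).symm
  obtain ⟨p0, ⟨d0, hd0⟩, _⟩ := RepPath.exists hc i rfl (linePath (baseE i) u) hx
  have h1 : p.Homotopic p0 := CanPath.unique hc hrel x p p0 hp ⟨i, _, ⟨d0, hd0⟩⟩
  have h2 : (p0.trans g).Homotopic p' := by
    refine CanPath.unique hc hrel y _ p' ⟨i, v, d0.trans d, ?_⟩ hp'
    intro t
    simp only [Path.trans_apply]
    split_ifs
    · rw [hd0]
    · rw [hg]
  exact (h1.hcomp (Path.Homotopic.refl g)).trans h2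

end setup

section localpart
variable {n : ℕ} {a : Fin (n + 1) → ℕ} {B : Type*} [TopologicalSpace B] {q : AMZ n → B}

theorem continuous_coord (k : Fin (n + 1)) : Continuous (fun y : AMZ n => y.1 k) :=
  (continuous_apply k).comp continuous_subtype_val

open Classical in
/-- Scale the `i`-th coordinate by `1 - s` where this makes sense. -/
noncomputable def sclX (i : Fin (n + 1)) (s : unitInterval) (y : AMZ n) : AMZ n :=
  if h : ∀ k, k ≠ i → y.1 k ≠ 0 then
    ⟨Function.update y.1 i ((1 - ((s : ℝ) : ℂ)) * y.1 i), by
      have : ∀ k, Function.update y.1 i ((1 - ((s : ℝ) : ℂ)) * y.1 i) k = 0 → k = i := by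
        intro k hk
        by_contra hki
        rw [Function.update_of_ne hki] at hk
        exact h k hki hk
      intro j k hj hk
      rw [this j hj, this k hk]⟩
  else y

theorem sclX_val (i : Fin (n + 1)) (s : unitInterval) (y : AMZ n)
    (h : ∀ k, k ≠ i → y.1 k ≠ 0) :
    (sclX i s y).1 = Function.update y.1 i ((1 - ((s : ℝ) : ℂ)) * y.1 i) := by
  rw [sclX, dif_pos h]

theorem continuousAt_sclX (i : Fin (n + 1)) (s : unitInterval) (y : AMZ n)
    (h : ∀ k, k ≠ i → y.1 k ≠ 0) :
    ContinuousAt (fun z : AMZ n × unitInterval => sclX i z.2 z.1) (y, s) := by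
  refine (Topology.IsInducing.subtypeVal (t := {v : Fin (n + 1) → ℂ |
    ∀ i j : Fin (n + 1), v i = 0 → v j = 0 → i = j})).continuousAt_iff.2 ?_
  have hev : ∀ᶠ z : AMZ n × unitInterval in nhds (y, s), ∀ k, k ≠ i → z.1.1 k ≠ 0 := by
    rw [Filter.eventually_all]
    intro k
    by_cases hk : k = i
    · simp [hk]
    · have hc : ContinuousAt (fun z : AMZ n × unitInterval => z.1.1 k) (y, s) := by
        have : Continuous (fun z : AMZ n × unitInterval => z.1.1 k) :=
            (continuous_coord k).comp continuous_fst
        exact this.continuousAt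
      filter_upwards [hc.eventually_ne (h k hk)] with z hz _
      exact hz
  have hc : Continuous (fun z : AMZ n × unitInterval =>
      Function.update z.1.1 i ((1 - ((z.2 : ℝ) : ℂ)) * z.1.1 i)) := by
    have h1 : Continuous (fun z : AMZ n × unitInterval => z.1.1) :=
      continuous_subtype_val.comp continuous_fst
    have h2 : Continuous (fun z : AMZ n × unitInterval => z.1.1 i) :=
      (continuous_coord i).comp continuous_fst
    have h3 : Continuous (fun z : AMZ n × unitInterval => (1 - ((z.2 : ℝ) : ℂ))) := by fun_prop
    exact h1.update i (h3.mul h2)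
  refine hc.continuousAt.congr ?_
  filter_upwards [hev] with z hz
  simp only [Function.comp]
  rw [sclX_val _ _ _ hz]

theorem q_sclX
    (hrel : ∀ x y, q x = q y ↔ ∃ t : ℂ, t ≠ 0 ∧ ∀ i, y.1 i = t ^ (a i) * x.1 i)
    (i : Fin (n + 1)) (s : unitInterval) (y z : AMZ n) (h : ∀ k, k ≠ i → y.1 k ≠ 0)
    (hyz : q y = q z) : q (sclX i s y) = q (sclX i s z) := by
  obtain ⟨t, ht, htz⟩ := (hrel _ _).1 hyz
  have h' : ∀ k, k ≠ i → z.1 k ≠ 0 := by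
    intro k hk
    rw [htz k]
    exact mul_ne_zero (pow_ne_zero _ ht) (h k hk)
  rw [hrel]
  refine ⟨t, ht, fun k => ?_⟩
  rw [sclX_val _ _ _ h, sclX_val _ _ _ h']
  by_cases hk : k = i
  · subst hk
    simp [htz k]; ring
  · simp [hk, htz k]

theorem local_good (hn : 1 ≤ n) (ha : ∀ i, 0 < a i) (hq : IsOpenQuotientMap q)
    (hrel : ∀ x y, q x = q y ↔ ∃ t : ℂ, t ≠ 0 ∧ ∀ i, y.1 i = t ^ (a i) * x.1 i)
    (x : B) : ∃ V ∈ nhds x, ∀ (y z : B) (g : Path y z), (∀ t, g t ∈ V) →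
      GoodPath (CanPath q) g := by
  obtain ⟨ξ, rfl⟩ := hq.surjective x
  obtain ⟨i, hi⟩ := exists_chart_index ξ
  have : Nontrivial (Fin (n + 1)) := Fin.nontrivial_iff_two_le.2 (by omega)
  obtain ⟨j, hj⟩ := exists_ne i
  have hc := hq.continuous
  let rep : B → AMZ n := Function.surjInv hq.surjective
  have hrep : ∀ b, q (rep b) = b := Function.surjInv_eq hq.surjective
  have haj : (a j : ℂ) ≠ 0 := by exact_mod_cast (ha j).ne'
  let f : Fin (n + 1) → AMZ n → ℂ := fun k y => y.1 k ^ (a j) / y.1 j ^ (a k)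
  have hf : ∀ k y, f k (rep (q y)) = f k y := by
    intro k y
    obtain ⟨t, ht, hty⟩ := (hrel _ _).1 (hrep (q y))
    simp only [f]
    rw [hty k, hty j, mul_pow, mul_pow, ← pow_mul, ← pow_mul, mul_comm (a j) (a k),
      mul_div_mul_left _ _ (pow_ne_zero _ ht)]
  let σ : B → Fin (n + 1) → ℂ := fun b k => if k = i then 0 else
    Complex.log (ξ.1 k) + (1 / (a j : ℂ)) * Complex.log (f k (rep b) / f k ξ)
  let G : B → unitInterval → B := fun b s => q (sclX i s (rep b))
  let O : Set (AMZ n) := {y | ∀ k, k ≠ i → y.1 k / ξ.1 k ∈ Complex.slitPlane ∧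
    |a j * Complex.arg (y.1 k / ξ.1 k) - a k * Complex.arg (y.1 j / ξ.1 j)| < Real.pi}
  have hO : O ∈ nhds ξ := by
    change ∀ᶠ y in nhds ξ, ∀ k, k ≠ i → _
    rw [Filter.eventually_all]
    intro k
    by_cases hk : k = i
    · simp [hk]
    have hdiv : ∀ k, ContinuousAt (fun y : AMZ n => y.1 k / ξ.1 k) ξ := by
      intro k
      have : Continuous (fun y : AMZ n => y.1 k / ξ.1 k) := (continuous_coord k).div_const _
      exact this.continuousAt
    have harg : ∀ k, k ≠ i → ContinuousAt (fun y : AMZ n => Complex.arg (y.1 k / ξ.1 k)) ξ := by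
      intro k hk
      refine ContinuousAt.comp (g := Complex.arg) (Complex.continuousAt_arg ?_) (hdiv k)
      rw [div_self (hi k hk)]; exact Complex.one_mem_slitPlane
    have h1 : ∀ᶠ y in nhds ξ, y.1 k / ξ.1 k ∈ Complex.slitPlane := by
      refine (hdiv k).eventually_mem (Complex.isOpen_slitPlane.mem_nhds ?_)
      rw [div_self (hi k hk)]; exact Complex.one_mem_slitPlane
    have h2 : ∀ᶠ y in nhds ξ, |a j * Complex.arg (y.1 k / ξ.1 k)
        - a k * Complex.arg (y.1 j / ξ.1 j)| < Real.pi := by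
      have hcc : ContinuousAt (fun y : AMZ n => |a j * Complex.arg (y.1 k / ξ.1 k)
        - a k * Complex.arg (y.1 j / ξ.1 j)|) ξ :=
        ((continuousAt_const.mul (harg k hk)).sub (continuousAt_const.mul (harg j hj))).abs
      refine hcc.eventually_lt continuousAt_const ?_
      simp [div_self (hi k hk), div_self (hi j hj), Real.pi_pos]
    filter_upwards [h1, h2] with y hy1 hy2 _
    exact ⟨hy1, hy2⟩
  have hOne : ∀ y ∈ O, ∀ k, k ≠ i → y.1 k ≠ 0 := by
    intro y hy k hk h0
    have := Complex.slitPlane_ne_zero (hy k hk).1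
    simp [h0] at this
  -- the ratio of invariants is the exponential of something in the strip
  have hratio : ∀ y ∈ O, ∀ k, k ≠ i →
      f k y / f k ξ ∈ Complex.slitPlane ∧ Complex.log (f k y / f k ξ) =
        a j * Complex.log (y.1 k / ξ.1 k) - a k * Complex.log (y.1 j / ξ.1 j) := by
    intro y hy k hk
    have e : f k y / f k ξ = Complex.exp
        (a j * Complex.log (y.1 k / ξ.1 k) - a k * Complex.log (y.1 j / ξ.1 j)) := by
      rw [Complex.exp_sub, Complex.exp_nat_mul, Complex.exp_nat_mul,
        Complex.exp_log (Complex.slitPlane_ne_zero (hy k hk).1),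
        Complex.exp_log (Complex.slitPlane_ne_zero (hy j hj).1)]
      simp only [f, div_pow]
      have h1 := hi k hk
      have h2 := hi j hj
      have h3 := hOne y hy k hk
      have h4 := hOne y hy j hj
      field_simp
    have him : (a j * Complex.log (y.1 k / ξ.1 k) - a k * Complex.log (y.1 j / ξ.1 j)).im =
        a j * Complex.arg (y.1 k / ξ.1 k) - a k * Complex.arg (y.1 j / ξ.1 j) := by
      simp [Complex.log_im]
    have hlt := abs_lt.1 (hy k hk).2
    rw [← him] at hlt
    have hlog := Complex.log_exp hlt.1 hlt.2.le
    refine ⟨?_, by rw [e, hlog]⟩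
    rw [e, Complex.mem_slitPlane_iff_arg]
    refine ⟨?_, Complex.exp_ne_zero _⟩
    rw [← Complex.log_im, hlog]
    exact hlt.2.ne
  have hσcont : ∀ y ∈ O, ContinuousAt σ (q y) := by
    intro y hy
    rw [← hq.continuousAt_comp_iff]
    refine continuousAt_pi.2 fun k => ?_
    simp only [Function.comp, σ, hf]
    split_ifs with hk
    · exact continuousAt_const
    · have hfc : ContinuousAt (fun y => f k y / f k ξ) y := by
        refine ContinuousAt.div_const (ContinuousAt.div ?_ ?_ ?_) _
        · exact ((continuous_coord k).pow _).continuousAt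
        · exact ((continuous_coord j).pow _).continuousAt
        · exact pow_ne_zero _ (hOne y hy j hj)
      exact continuousAt_const.add (continuousAt_const.mul (hfc.clog (hratio y hy k hk).1))
  have hGq : ∀ y ∈ O, ∀ s, G (q y) s = q (sclX i s y) := by
    intro y hy s
    exact (q_sclX hrel i s y _ (hOne y hy) (hrep (q y)).symm).symm
  have hGq' : ∀ y : AMZ n, (∀ k, k ≠ i → y.1 k ≠ 0) → ∀ s, G (q y) s = q (sclX i s y) := by
    intro y hy s
    exact (q_sclX hrel i s y _ hy (hrep (q y)).symm).symm
  have hGcont : ∀ y ∈ O, ∀ s, ContinuousAt (fun z : B × unitInterval => G z.1 z.2) (q y, s) := by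
    intro y hy s
    have hop : IsOpenQuotientMap (Prod.map q (id : unitInterval → unitInterval)) :=
      hq.prodMap IsOpenQuotientMap.id
    have := hop.continuousAt_comp_iff (g := fun z : B × unitInterval => G z.1 z.2) (x := (y, s))
    refine this.1 ?_
    have h1 : ContinuousAt (fun z : AMZ n × unitInterval => q (sclX i z.2 z.1)) (y, s) :=
      ContinuousAt.comp (g := q) hc.continuousAt (continuousAt_sclX i s y (hOne y hy))
    refine h1.congr ?_
    have hev : ∀ᶠ z : AMZ n × unitInterval in nhds (y, s), ∀ k, k ≠ i → z.1.1 k ≠ 0 := by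
      rw [Filter.eventually_all]
      intro k
      by_cases hk : k = i
      · simp [hk]
      · have hc : ContinuousAt (fun z : AMZ n × unitInterval => z.1.1 k) (y, s) := by
          have : Continuous (fun z : AMZ n × unitInterval => z.1.1 k) :=
            (continuous_coord k).comp continuous_fst
          exact this.continuousAt
        filter_upwards [hc.eventually_ne (hOne y hy k hk)] with z hz _
        exact hz
    filter_upwards [hev] with z hz
    simp only [Function.comp, Prod.map, id]
    rw [hGq' _ hz]
  have hG0 : ∀ y ∈ O, G (q y) 0 = q y := by
    intro y hy
    rw [hGq y hy]
    congr 1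
    apply Subtype.ext
    rw [sclX_val _ _ _ (hOne y hy)]
    simp
  have hG1 : ∀ y ∈ O, G (q y) 1 = q (chartQ i (σ (q y))) := by
    intro y hy
    rw [hGq y hy, hrel]
    refine ⟨Complex.exp (-(Complex.log (y.1 j / ξ.1 j) / a j)), Complex.exp_ne_zero _, fun k => ?_⟩
    rw [sclX_val _ _ _ (hOne y hy), chartQ_val]
    by_cases hk : k = i
    · subst hk; simp [σ]
    · simp only [hk, if_false, σ, hf, ne_eq, not_false_eq_true, Function.update_of_ne]
      rw [(hratio y hy k hk).2, ← Complex.exp_nat_mul, Complex.exp_add, Complex.exp_log (hi k hk)]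
      have e1 : 1 / (a j : ℂ) * (a j * Complex.log (y.1 k / ξ.1 k)
          - a k * Complex.log (y.1 j / ξ.1 j)) = Complex.log (y.1 k / ξ.1 k) +
          a k * -(Complex.log (y.1 j / ξ.1 j) / a j) := by
        field_simp
        ring
      rw [e1, Complex.exp_add, Complex.exp_log (Complex.slitPlane_ne_zero (hy k hk).1)]
      have := hi k hk
      field_simp
  refine ⟨q '' O, hq.isOpenMap.image_mem_nhds hO, ?_⟩
  intro x z g hg
  have hside : ∀ b ∈ q '' O, ∃ u : Fin (n + 1) → ℂ, ∃ v, ∃ d : Path u v,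
      ∀ s, G b s = q (chartQ i (d s)) := by
    rintro _ ⟨y, hy, rfl⟩
    refine ⟨_, _, linePath (fun k => if k = i then y.1 k else Complex.log (y.1 k))
      (fun k => if k = i then 0 else Complex.log (y.1 k)), fun s => ?_⟩
    rw [hGq y hy]
    congr 1
    ext k
    rw [sclX_val _ _ _ (hOne y hy), chartQ_val, linePath_apply]
    by_cases hk : k = i
    · subst hk; simp; ring
    · simp [hk, Complex.exp_log (hOne y hy k hk)]
  have hKc : Continuous fun z : unitInterval × unitInterval => G (g z.1) z.2 := by
    rw [continuous_iff_continuousAt]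
    rintro ⟨t, s⟩
    obtain ⟨y, hy, hyt⟩ := hg t
    have h1 := hGcont y hy s
    rw [hyt] at h1
    refine ContinuousAt.comp (g := fun z : B × unitInterval => G z.1 z.2)
      (f := fun z : unitInterval × unitInterval => (g z.1, z.2)) h1 ?_
    exact Continuous.continuousAt (by fun_prop)
  have hσc : Continuous fun t => σ (g t) := by
    rw [continuous_iff_continuousAt]
    intro t
    obtain ⟨y, hy, hyt⟩ := hg t
    have h1 := hσcont y hy
    rw [hyt] at h1
    exact ContinuousAt.comp (g := σ) h1 g.continuous.continuousAt
  have hgx : g 0 = x := g.source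
  have hgz : g 1 = z := g.target
  have hG0' : ∀ b ∈ q '' O, G b 0 = b := by rintro _ ⟨y, hy, rfl⟩; exact hG0 y hy
  have hG1' : ∀ b ∈ q '' O, G b 1 = q (chartQ i (σ b)) := by rintro _ ⟨y, hy, rfl⟩; exact hG1 y hy
  have hx : x ∈ q '' O := hgx ▸ hg 0
  have hz : z ∈ q '' O := hgz ▸ hg 1
  let g' : Path (G x 1) (G z 1) :=
    { toFun := fun t => G (g t) 1
      continuous_toFun := hKc.comp (Continuous.prodMk_left 1)
      source' := by simp
      target' := by simp }
  let r : Path x (G x 1) :=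
    { toFun := fun s => G (g 0) s
      continuous_toFun := hKc.comp (Continuous.prodMk_right 0)
      source' := by simp only [hgx]; exact hG0' x hx
      target' := by simp }
  let s : Path z (G z 1) :=
    { toFun := fun s => G (g 1) s
      continuous_toFun := hKc.comp (Continuous.prodMk_right 1)
      source' := by simp only [hgz]; exact hG0' z hz
      target' := by simp }
  have H := square_homotopic (fun z : unitInterval × unitInterval => G (g z.1) z.2) hKc g s r g'
    (fun t => (hG0' _ (hg t)).symm) (fun _ => rfl) (fun _ => rfl) (fun _ => rfl)
  refine GoodPath.cancel (CanPath q) (CanPath.exists hc hq.surjective) (s := s) (r := r) (g' := g')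
    ?_ ?_ ?_ H
  · obtain ⟨u, v, d, hd⟩ := hside _ (hg 1)
    exact good_of_chart hc hrel i s d hd
  · obtain ⟨u, v, d, hd⟩ := hside _ (hg 0)
    exact good_of_chart hc hrel i r d hd
  · refine good_of_chart hc hrel i g' (⟨⟨_, hσc⟩, rfl, rfl⟩ : Path (σ (g 0)) (σ (g 1))) ?_
    intro t
    exact hG1' _ (hg t)

theorem simplyConnected_of_openQuotient (hn : 1 ≤ n) (ha : ∀ i, 0 < a i) (hq : IsOpenQuotientMap q)
    (hrel : ∀ x y, q x = q y ↔ ∃ t : ℂ, t ≠ 0 ∧ ∀ i, y.1 i = t ^ (a i) * x.1 i) :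
    SimplyConnectedSpace B :=
  simplyConnected_of_canonical (CanPath q) (CanPath.exists hq.continuous hq.surjective)
    (CanPath.unique hq.continuous hrel) (local_good hn ha hq hrel)

end localpart

theorem wprojRel_equivalence (n : ℕ) (a : Fin (n + 1) → ℕ) : Equivalence (wprojRel n a) where
  refl x := ⟨1, one_ne_zero, by simp⟩
  symm := by
    rintro x y ⟨t, ht, h⟩
    refine ⟨t⁻¹, inv_ne_zero ht, fun i => ?_⟩
    rw [h i, inv_pow, inv_mul_cancel_left₀ (pow_ne_zero _ ht)]
  trans := by
    rintro x y z ⟨t, ht, h⟩ ⟨s, hs, h'⟩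
    refine ⟨s * t, mul_ne_zero hs ht, fun i => ?_⟩
    rw [h' i, h i, mul_pow, mul_assoc]

theorem wproj_mk_eq (n : ℕ) (a : Fin (n + 1) → ℕ) (x y) :
    (Quot.mk (wprojRel n a) x : WProj n a) = Quot.mk (wprojRel n a) y ↔ wprojRel n a x y := by
  constructor
  · intro h
    exact (wprojRel_equivalence n a).eqvGen_iff.1 (Quot.eqvGen_exact h)
  · exact fun h => Quot.sound h

theorem wproj_isOpenMap (n : ℕ) (a : Fin (n + 1) → ℕ) :
    IsOpenMap (fun x => (Quot.mk (wprojRel n a) x : WProj n a)) := by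
  intro O hO
  have hquot : Topology.IsQuotientMap (fun x => (Quot.mk (wprojRel n a) x : WProj n a)) :=
    isQuotientMap_quot_mk
  rw [← hquot.isOpen_preimage]
  have key : ∀ (t : ℂ) (ht : t ≠ 0) (x : {v : Fin (n + 1) → ℂ // v ≠ 0}),
      (fun i => t ^ (a i) * x.1 i) ≠ 0 := by
    intro t ht x h0
    apply x.2
    ext i
    have := congrFun h0 i
    simpa [ht] using this
  have : (fun x => (Quot.mk (wprojRel n a) x : WProj n a)) ⁻¹'
      ((fun x => (Quot.mk (wprojRel n a) x : WProj n a)) '' O) =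
      ⋃ t : {t : ℂ // t ≠ 0}, (fun x : {v : Fin (n + 1) → ℂ // v ≠ 0} =>
        (⟨fun i => t.1 ^ (a i) * x.1 i, key t.1 t.2 x⟩ : {v : Fin (n + 1) → ℂ // v ≠ 0})) ⁻¹' O := by
    ext x
    simp only [Set.mem_preimage, Set.mem_image, Set.mem_iUnion]
    constructor
    · rintro ⟨y, hy, hxy⟩
      obtain ⟨t, ht, h⟩ := (wproj_mk_eq n a _ _).1 hxy.symm
      refine ⟨⟨t, ht⟩, ?_⟩
      convert hy using 1
      apply Subtype.ext
      ext i
      exact (h i).symm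
    · rintro ⟨t, ht⟩
      refine ⟨_, ht, ((wproj_mk_eq n a _ _).2 ⟨t.1, t.2, fun i => rfl⟩).symm⟩
  rw [this]
  refine isOpen_iUnion fun t => hO.preimage ?_
  refine Continuous.subtype_mk (continuous_pi fun i => ?_) _
  exact continuous_const.mul ((continuous_apply i).comp continuous_subtype_val)

/-- For positive weights with `gcd(a₀,…,aₙ) = 1`, the subset of
`ℙ(a₀,…,aₙ)` of classes having a representative with at most one zero coordinate
(with the subspace topology) is simply connected. -/
theorem wproj_atMostOneZero_simplyConnected
    (n : ℕ) (hn : 1 ≤ n) (a : Fin (n + 1) → ℕ) (ha : ∀ i, 0 < a i)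
    (hgcd : Finset.univ.gcd a = 1) :
    SimplyConnectedSpace
      ↥{z : WProj n a | ∃ x : {v : Fin (n + 1) → ℂ // v ≠ 0},
        Quot.mk (wprojRel n a) x = z ∧
        ∀ i j : Fin (n + 1), (x : Fin (n + 1) → ℂ) i = 0 →
          (x : Fin (n + 1) → ℂ) j = 0 → i = j} := by
  have hne : ∀ x : AMZ n, x.1 ≠ 0 := by
    intro x h
    have := x.2 0 1 (by simp [h]) (by simp [h])
    have : Nontrivial (Fin (n + 1)) := Fin.nontrivial_iff_two_le.2 (by omega)
    have h2 : (0 : Fin (n + 1)) ≠ Fin.last n := by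
      intro h3
      have := congrArg Fin.val h3
      simp at this
      omega
    exact h2 (x.2 _ _ (by simp [h]) (by simp [h]))
  let q : AMZ n → ↥{z : WProj n a | ∃ x : {v : Fin (n + 1) → ℂ // v ≠ 0},
        Quot.mk (wprojRel n a) x = z ∧
        ∀ i j : Fin (n + 1), (x : Fin (n + 1) → ℂ) i = 0 →
          (x : Fin (n + 1) → ℂ) j = 0 → i = j} :=
    fun x => ⟨Quot.mk (wprojRel n a) ⟨x.1, hne x⟩, ⟨⟨x.1, hne x⟩, rfl, x.2⟩⟩
  have hcq : Continuous q := by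
    refine Continuous.subtype_mk ?_ _
    exact continuous_quot_mk.comp (Continuous.subtype_mk continuous_subtype_val _)
  have hsat : ∀ x y : {v : Fin (n + 1) → ℂ // v ≠ 0}, wprojRel n a x y →
      (∀ i j : Fin (n + 1), x.1 i = 0 → x.1 j = 0 → i = j) →
      (∀ i j : Fin (n + 1), y.1 i = 0 → y.1 j = 0 → i = j) := by
    rintro x y ⟨t, ht, h⟩ hx i j hi hj
    rw [h] at hi hj
    simp only [mul_eq_zero, pow_eq_zero_iff', ht, false_and, false_or] at hi hj
    exact hx i j hi hj
  refine simplyConnected_of_openQuotient (q := q) (a := a) hn ha ⟨?_, hcq, ?_⟩ ?_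
  · rintro ⟨z, x, rfl, hx⟩
    exact ⟨⟨x.1, hx⟩, rfl⟩
  · intro O hO
    obtain ⟨O', hO', rfl⟩ := isOpen_induced_iff.1 hO
    have h1 : IsOpen ((fun x : {v : Fin (n + 1) → ℂ // v ≠ 0} => x.1) ⁻¹' O') :=
      hO'.preimage continuous_subtype_val
    refine isOpen_induced_iff.2 ⟨_, wproj_isOpenMap n a _ h1, ?_⟩
    ext ⟨z, x, rfl, hx⟩
    simp only [Set.mem_preimage, Set.mem_image]
    constructor
    · rintro ⟨y, hy, hxy⟩
      have hr := (wproj_mk_eq n a _ _).1 hxy.symm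
      exact ⟨⟨y.1, hsat _ _ hr hx⟩, hy, Subtype.ext hxy⟩
    · rintro ⟨y, hy, hxy⟩
      exact ⟨⟨y.1, hne y⟩, hy, congrArg Subtype.val hxy⟩
  · intro x y
    rw [Subtype.ext_iff]
    exact wproj_mk_eq n a ⟨x.1, hne x⟩ ⟨y.1, hne y⟩
end

section
/- Let r ≥ 1 and let a be an integer with gcd(a, r) = 1 and gcd(a + 1, r) = 1. Let ε be a primitive r-th root of unity, and let g : ℙ²(ℂ) → ℙ²(ℂ) be given by g([x₀ : x₁ : x₂]) = [x₀ : ε^{a+1} x₁ : ε^{a} x₂]. Let U ⊆ ℙ²(ℂ) be the set of points having a representative with at most one zero coordinate, which is invariant under g. Then the fundamental group of the quotient topological space U/⟨g⟩ (the quotient of U by the orbit equivalence relation of the cyclic group generated by g) is isomorphic to ℤ/rℤ, at any basepoint. -/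
/-- The scalar equivalence on `ℂ³ \ {0}`. -/
def projRel3 (x y : {v : Fin 3 → ℂ // v ≠ 0}) : Prop :=
  ∃ t : ℂ, t ≠ 0 ∧ ∀ i, (y : Fin 3 → ℂ) i = t * (x : Fin 3 → ℂ) i

/-- The complex projective plane `ℙ²(ℂ)`, as the quotient topological space of
`ℂ³ \ {0}` by scalar multiplication. -/
def P2 : Type := Quot projRel3

instance : TopologicalSpace P2 := inferInstanceAs (TopologicalSpace (Quot projRel3))

/-- The subset `U ⊆ ℙ²(ℂ)` of points having a representative with at most one zero
coordinate. -/
def goodLocus : Set P2 :=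
  {p : P2 | ∃ x : {v : Fin 3 → ℂ // v ≠ 0}, Quot.mk projRel3 x = p ∧
    ∀ i j : Fin 3, (x : Fin 3 → ℂ) i = 0 → (x : Fin 3 → ℂ) j = 0 → i = j}

/-- The orbit relation on `U` of the cyclic group generated by `g`. -/
def cyclicOrbitRel (g : P2 → P2) (u v : ↥goodLocus) : Prop :=
  ∃ k : ℕ, g^[k] (u : P2) = (v : P2)

section Helpers

open Topology unitInterval

theorem pp_homotopic_of_mem {X : Type*} [TopologicalSpace X] {s : Set X} (hs : IsSimplyConnected s)
    {x y : X} (p q : Path x y) (hp : ∀ t, p t ∈ s) (hq : ∀ t, q t ∈ s) : Path.Homotopic p q := by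
  have := hs.simplyConnectedSpace
  have hx : x ∈ s := by simpa using hp 0
  have hy : y ∈ s := by simpa using hp 1
  let p' : Path (⟨x, hx⟩ : s) ⟨y, hy⟩ :=
    { toFun := fun t ↦ ⟨p t, hp t⟩, source' := by simp, target' := by simp }
  let q' : Path (⟨x, hx⟩ : s) ⟨y, hy⟩ :=
    { toFun := fun t ↦ ⟨q t, hq t⟩, source' := by simp, target' := by simp }
  have h := (SimplyConnectedSpace.paths_homotopic p' q').map ⟨Subtype.val, continuous_subtype_val⟩
  exact h

theorem pp_vanKampen {X : Type*} [TopologicalSpace X] {A B : Set X} (hA : IsOpen A) (hB : IsOpen B)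
    (hAB : A ∪ B = Set.univ) (sA : IsSimplyConnected A) (sB : IsSimplyConnected B)
    (pc : IsPathConnected (A ∩ B)) : SimplyConnectedSpace X := by
  have memAB (x : X) : x ∈ A ∨ x ∈ B := by
    have : x ∈ A ∪ B := hAB ▸ Set.mem_univ x
    exact this
  obtain ⟨x₀, hx₀⟩ := pc.nonempty
  have hc (x : X) : ∃ c : Path x₀ x, (x ∈ A → ∀ t, c t ∈ A) ∧ (x ∈ B → ∀ t, c t ∈ B) := by
    by_cases h1 : x ∈ A
    · by_cases h2 : x ∈ B
      · have h := pc.joinedIn x₀ hx₀ x ⟨h1, h2⟩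
        exact ⟨h.somePath, fun _ t ↦ (h.somePath_mem t).1, fun _ t ↦ (h.somePath_mem t).2⟩
      · have h := sA.isPathConnected.joinedIn x₀ hx₀.1 x h1
        exact ⟨h.somePath, fun _ t ↦ h.somePath_mem t, fun h' ↦ absurd h' h2⟩
    · have h := sB.isPathConnected.joinedIn x₀ hx₀.2 x ((memAB x).resolve_left h1)
      exact ⟨h.somePath, fun h' ↦ absurd h' h1, fun _ t ↦ h.somePath_mem t⟩
  choose c cA cB using hc
  have step {s : Set X} (hs : IsSimplyConnected s) (cs : ∀ x, x ∈ s → ∀ t, c x t ∈ s)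
      {x y : X} (p : Path x y) (hp : ∀ t, p t ∈ s) : Path.Homotopic ((c x).trans p) (c y) := by
    have hx : x ∈ s := by simpa using hp 0
    have hy : y ∈ s := by simpa using hp 1
    refine pp_homotopic_of_mem hs _ _ (fun t ↦ ?_) (cs y hy)
    have : ((c x).trans p) t ∈ Set.range ((c x).trans p) := ⟨t, rfl⟩
    rw [Path.trans_range] at this
    rcases this with ⟨u, hu⟩ | ⟨u, hu⟩
    · rw [← hu]; exact cs x hx u
    · rw [← hu]; exact hp u
  have main {x y : X} (γ : Path x y) : Path.Homotopic ((c x).trans γ) (c y) := by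
    obtain ⟨t, t0, tm, ⟨N, hN⟩, ht⟩ := exists_monotone_Icc_subset_open_cover_unitInterval
      (c := fun b : Bool ↦ γ ⁻¹' (if b then A else B))
      (fun b ↦ by cases b <;> simp [hA.preimage γ.continuous, hB.preimage γ.continuous])
      (fun u _ ↦ by
        rcases memAB (γ u) with h | h
        · exact Set.mem_iUnion.2 ⟨true, by simpa using h⟩
        · exact Set.mem_iUnion.2 ⟨false, by simpa using h⟩)
    have key (n : ℕ) : Path.Homotopic ((c (γ 0)).trans (γ.subpath 0 (t n))) (c (γ (t n))) := by
      induction n with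
      | zero =>
        rw [t0, Path.subpath_self]
        exact ⟨Path.Homotopy.transRefl _⟩
      | succ n ih =>
        have h1 : Path.Homotopic ((c (γ (t n))).trans (γ.subpath (t n) (t (n+1))))
            (c (γ (t (n+1)))) := by
          have hr : ∀ u, γ.subpath (t n) (t (n+1)) u ∈ γ '' Set.Icc (t n) (t (n+1)) := by
            intro u
            rw [← Path.range_subpath_of_le _ _ _ (tm n.le_succ)]
            exact ⟨u, rfl⟩
          obtain ⟨b, hb⟩ := ht n
          cases b
          · refine step sB cB _ fun u ↦ ?_
            obtain ⟨v, hv, e⟩ := hr u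
            rw [← e]
            simpa using hb hv
          · refine step sA cA _ fun u ↦ ?_
            obtain ⟨v, hv, e⟩ := hr u
            rw [← e]
            simpa using hb hv
        have h2 : Path.Homotopic (γ.subpath 0 (t (n+1)))
            ((γ.subpath 0 (t n)).trans (γ.subpath (t n) (t (n+1)))) :=
          Path.Homotopic.symm ⟨Path.Homotopy.subpathTransSubpath γ _ _ _⟩
        refine ((Path.Homotopic.refl _).hcomp h2).trans ?_
        refine Path.Homotopic.trans
          (Path.Homotopic.symm ⟨Path.Homotopy.transAssoc _ _ _⟩) ?_
        exact (ih.hcomp (Path.Homotopic.refl _)).trans h1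
    have k := key N
    rw [hN N le_rfl, Path.subpath_zero_one] at k
    have gen : ∀ (x' y' : X) (hx : x' = x) (hy : y' = y),
        Path.Homotopic ((c x').trans (γ.cast hx hy)) (c y') →
        Path.Homotopic ((c x).trans γ) (c y) := by
      rintro _ _ rfl rfl h
      exact h
    exact gen _ _ γ.source γ.target k
  rw [simply_connected_iff_paths_homotopic']
  refine ⟨⟨⟨x₀⟩, fun x y ↦ ⟨(c x).symm.trans (c y)⟩⟩, fun {x y} p q ↦ ?_⟩
  have h := (main p).trans (main q).symm
  rw [← Path.Homotopic.Quotient.eq] at h ⊢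
  simp only [Path.Homotopic.Quotient.mk_trans] at h
  have h2 := congrArg (fun z ↦ Path.Homotopic.Quotient.trans
    (Path.Homotopic.Quotient.symm (Path.Homotopic.Quotient.mk (c x))) z) h
  simpa [← Path.Homotopic.Quotient.trans_assoc] using h2

theorem pp_vanKampen_set {X : Type*} [TopologicalSpace X] {A B : Set X} (hA : IsOpen A)
    (hB : IsOpen B) (sA : IsSimplyConnected A) (sB : IsSimplyConnected B)
    (pc : IsPathConnected (A ∩ B)) : IsSimplyConnected (A ∪ B) := by
  have e : IsEmbedding (Subtype.val : ↥(A ∪ B) → X) := .subtypeVal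
  have im {C : Set X} (hC : C ⊆ A ∪ B) :
      (Subtype.val : ↥(A ∪ B) → X) '' (Subtype.val ⁻¹' C) = C := by
    rw [Subtype.image_preimage_coe]; exact Set.inter_eq_self_of_subset_right hC
  refine pp_vanKampen (A := Subtype.val ⁻¹' A) (B := Subtype.val ⁻¹' B)
    (hA.preimage continuous_subtype_val) (hB.preimage continuous_subtype_val) ?_ ?_ ?_ ?_
  · ext x; exact ⟨fun _ ↦ trivial, fun _ ↦ x.2⟩
  · rw [← e.isSimplyConnected_image, im Set.subset_union_left]; exact sA
  · rw [← e.isSimplyConnected_image, im Set.subset_union_right]; exact sB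
  · rw [← Set.preimage_inter, e.isInducing.isPathConnected_iff,
      im (Set.inter_subset_left.trans Set.subset_union_left)]
    exact pc

/-- `ℂ² \ {0}` is simply connected. -/
theorem pp_punctured : IsSimplyConnected ({0}ᶜ : Set (Fin 2 → ℂ)) := by
  let A : Set (Fin 2 → ℂ) := {v | v 0 ∈ Complex.slitPlane ∨ v 1 ≠ 0}
  let B : Set (Fin 2 → ℂ) := {v | -v 0 ∈ Complex.slitPlane ∨ v 1 ≠ 0}
  have hA : IsOpen A := IsOpen.union (Complex.isOpen_slitPlane.preimage (continuous_apply (A := fun _ ↦ ℂ) (0 : Fin 2))) (isOpen_ne.preimage (continuous_apply (A := fun _ ↦ ℂ) (1 : Fin 2)))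
  have hB : IsOpen B := IsOpen.union (Complex.isOpen_slitPlane.preimage (continuous_apply (A := fun _ ↦ ℂ) (0 : Fin 2)).neg) (isOpen_ne.preimage (continuous_apply (A := fun _ ↦ ℂ) (1 : Fin 2)))
  have hun : A ∪ B = {0}ᶜ := by
    ext v
    simp only [A, B, Complex.mem_slitPlane_iff, Set.mem_union, Set.mem_ofPred_eq,
      Set.mem_compl_iff, Set.mem_singleton_iff, Complex.neg_re, Complex.neg_im, funext_iff,
      Fin.forall_fin_two, Pi.zero_apply, Complex.ext_iff, Complex.zero_re, Complex.zero_im]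
    have e1 : v 1 = 0 ↔ (v 1).re = 0 ∧ (v 1).im = 0 := by simp [Complex.ext_iff]
    clear hA hB A B
    rcases lt_trichotomy (v 0).re 0 with h | h | h <;> grind
  have sA : IsSimplyConnected A := by
    have st : StarConvex ℝ (![1, 0] : Fin 2 → ℂ) A := by
      intro v hv a b ha hb hab
      by_cases h1 : v 1 = 0
      · left
        have := Complex.starConvex_one_slitPlane (hv.resolve_right (by simpa using h1)) ha hb hab
        simpa using this
      · rcases eq_or_ne b 0 with rfl | hb0
        · left
          obtain rfl : a = 1 := by linarith
          simp
        · right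
          simp [hb0, h1]
    have := st.contractibleSpace ⟨![1, 0], by left; simp⟩
    exact SimplyConnectedSpace.ofContractible _
  have sB : IsSimplyConnected B := by
    have : B = Homeomorph.neg (Fin 2 → ℂ) ⁻¹' A := by ext v; simp [A, B]
    rw [this, Homeomorph.isSimplyConnected_preimage]
    exact sA
  rw [← hun]
  refine pp_vanKampen_set hA hB sA sB ?_
  have hW : ∀ v : Fin 2 → ℂ, v 1 ≠ 0 → JoinedIn (A ∩ B) ![0, 1] v := by
    intro v hv
    have : IsPathConnected ({0}ᶜ : Set ℂ) :=
      isPathConnected_compl_singleton_of_one_lt_rank (by simp) 0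
    have j := this.joinedIn 1 (by simp) (v 1) (by simpa using hv)
    refine ⟨⟨⟨fun t ↦ ![t * v 0, j.somePath t], ?_⟩, ?_, ?_⟩, fun t ↦ ?_⟩
    · refine continuous_pi fun i ↦ ?_
      fin_cases i <;> simp <;> fun_prop
    · simp
    · ext i; fin_cases i <;> simp
    · have : j.somePath t ≠ 0 := j.somePath_mem t
      exact ⟨Or.inr this, Or.inr this⟩
  refine ⟨![0, 1], ⟨Or.inr (by simp), Or.inr (by simp)⟩, fun {v} hv ↦ ?_⟩
  by_cases h1 : v 1 = 0
  · refine (hW ![v 0, 1] (by simp)).trans (JoinedIn.of_segment_subset ?_)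
    rintro w ⟨a, b, ha, hb, hab, rfl⟩
    have e : (a • ![v 0, 1] + b • v) 0 = v 0 := by
      simp only [Pi.add_apply, Pi.smul_apply, Matrix.cons_val_zero, ← add_smul, hab, one_smul]
    have h0 := hv.1.resolve_right (by simpa using h1)
    have h0' := hv.2.resolve_right (by simpa using h1)
    exact ⟨Or.inl (by rw [e]; exact h0), Or.inl (by rw [e]; exact h0')⟩
  · exact hW v h1

theorem pp_coord (i : Fin 3) : Continuous fun x : {v : Fin 3 → ℂ // v ≠ 0} ↦ x.1 i :=
  (continuous_apply i).comp continuous_subtype_val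

/-- The quotient map. -/
def ppMk (x : {v : Fin 3 → ℂ // v ≠ 0}) : P2 := Quot.mk projRel3 x

theorem pp_equiv : Equivalence projRel3 where
  refl x := ⟨1, one_ne_zero, by simp⟩
  symm := by
    rintro x y ⟨t, ht, h⟩
    exact ⟨t⁻¹, inv_ne_zero ht, fun i ↦ by rw [h i]; field_simp⟩
  trans := by
    rintro x y z ⟨t, ht, h⟩ ⟨s, hs, h'⟩
    exact ⟨s * t, mul_ne_zero hs ht, fun i ↦ by rw [h' i, h i]; ring⟩

theorem ppMk_eq {x y : {v : Fin 3 → ℂ // v ≠ 0}} : ppMk x = ppMk y ↔ projRel3 x y :=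
  Quot.eq.trans pp_equiv.eqvGen_iff

theorem ppMk_surj : Function.Surjective ppMk := Quot.mk_surjective

theorem ppMk_quot : IsQuotientMap ppMk := isQuotientMap_quot_mk

theorem ppMk_open : IsOpenMap ppMk := by
  intro W hW
  rw [← ppMk_quot.isOpen_preimage]
  have : ppMk ⁻¹' (ppMk '' W) = ⋃ t : ℂˣ,
      (fun x : {v : Fin 3 → ℂ // v ≠ 0} ↦
        (⟨fun i ↦ t * x.1 i, fun h ↦ x.2 (funext fun i ↦ by simpa using congrFun h i)⟩ :
          {v : Fin 3 → ℂ // v ≠ 0})) ⁻¹' W := by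
    ext x
    simp only [Set.mem_preimage, Set.mem_image, Set.mem_iUnion]
    constructor
    · rintro ⟨y, hy, e⟩
      obtain ⟨t, ht, h⟩ := ppMk_eq.1 e.symm
      refine ⟨Units.mk0 t ht, ?_⟩
      convert hy using 1
      exact Subtype.ext (funext fun i ↦ (h i).symm)
    · rintro ⟨t, h⟩
      exact ⟨_, h, (ppMk_eq.2 ⟨t, t.ne_zero, fun i ↦ rfl⟩).symm⟩
  rw [this]
  refine isOpen_iUnion fun t ↦ hW.preimage ?_
  refine Continuous.subtype_mk ?_ _
  exact continuous_pi fun i ↦ continuous_const.mul (pp_coord i)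

theorem ppMk_openQuot : IsOpenQuotientMap ppMk :=
  ⟨ppMk_surj, ppMk_quot.continuous, ppMk_open⟩

instance pp_t2 : T2Space P2 := by
  rw [t2Space_iff_of_isOpenQuotientMap ppMk_openQuot]
  have : {q : {v : Fin 3 → ℂ // v ≠ 0} × {v : Fin 3 → ℂ // v ≠ 0} | ppMk q.1 = ppMk q.2} =
      ⋂ i : Fin 3, ⋂ j : Fin 3, {q | q.1.1 i * q.2.1 j = q.1.1 j * q.2.1 i} := by
    ext ⟨x, y⟩
    simp only [Set.mem_ofPred_eq, Set.mem_iInter, ppMk_eq]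
    constructor
    · rintro ⟨t, ht, h⟩ i j
      rw [h i, h j]; ring
    · intro h
      obtain ⟨i, hi⟩ := Function.ne_iff.1 x.2
      simp only [Pi.zero_apply] at hi
      have key : ∀ j, y.1 j = (y.1 i / x.1 i) * x.1 j := by
        intro j
        have := h i j
        field_simp
        linear_combination this
      refine ⟨y.1 i / x.1 i, fun h0 ↦ y.2 (funext fun j ↦ ?_), key⟩
      rw [key j, h0]; simp
  rw [this]
  refine isClosed_iInter fun i ↦ isClosed_iInter fun j ↦ isClosed_eq ?_ ?_
  · exact ((pp_coord _).comp continuous_fst).mul ((pp_coord _).comp continuous_snd)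
  · exact ((pp_coord _).comp continuous_fst).mul ((pp_coord _).comp continuous_snd)

/-- The affine charts of the projective plane. -/
def ppPre (i : Fin 3) (v : Fin 2 → ℂ) : {v : Fin 3 → ℂ // v ≠ 0} :=
  ⟨i.insertNth (α := fun _ ↦ ℂ) 1 v, fun h ↦ by simpa using congrFun h i⟩

/-- The affine charts of the projective plane. -/
def ppChart (i : Fin 3) (v : Fin 2 → ℂ) : P2 := ppMk (ppPre i v)

@[simp] theorem ppPre_self (i : Fin 3) (v : Fin 2 → ℂ) : (ppPre i v).1 i = 1 := by simp [ppPre]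

@[simp] theorem ppPre_succAbove (i : Fin 3) (v : Fin 2 → ℂ) (j : Fin 2) :
    (ppPre i v).1 (i.succAbove j) = v j := by simp [ppPre]

theorem ppChart_eq_iff (i : Fin 3) (v : Fin 2 → ℂ) (x : {v : Fin 3 → ℂ // v ≠ 0}) :
    ppChart i v = ppMk x ↔ x.1 i ≠ 0 ∧ (fun j ↦ x.1 (i.succAbove j) / x.1 i) = v := by
  rw [ppChart, ppMk_eq]
  constructor
  · rintro ⟨t, ht, h⟩
    have hi := h i
    simp only [ppPre_self, mul_one] at hi
    refine ⟨by rwa [hi], funext fun j ↦ ?_⟩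
    rw [h, hi, ppPre_succAbove]
    field_simp
  · rintro ⟨h, rfl⟩
    refine ⟨x.1 i, h, fun k ↦ ?_⟩
    rcases Fin.eq_self_or_eq_succAbove i k with rfl | ⟨j, rfl⟩
    · simp
    · rw [ppPre_succAbove]; field_simp

theorem ppChart_cont (i : Fin 3) : Continuous (ppChart i) := by
  refine ppMk_quot.continuous.comp (Continuous.subtype_mk ?_ _)
  exact continuous_const.finInsertNth (A := fun _ ↦ ℂ) i continuous_id

theorem ppChart_emb (i : Fin 3) : IsOpenEmbedding (ppChart i) := by
  refine .of_continuous_injective_isOpenMap (ppChart_cont i) ?_ ?_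
  · intro v w h
    have := ((ppChart_eq_iff i v (ppPre i w)).1 h).2
    rw [← this]
    ext j; simp
  · intro W hW
    rw [← ppMk_quot.isOpen_preimage]
    have : ppMk ⁻¹' (ppChart i '' W) = {x | x.1 i ≠ 0} ∩
        (fun x : {v : Fin 3 → ℂ // v ≠ 0} ↦ (fun j ↦ x.1 (i.succAbove j) / x.1 i)) ⁻¹' W := by
      ext x
      simp only [Set.mem_preimage, Set.mem_image, ppChart_eq_iff, Set.mem_inter_iff,
        Set.mem_ofPred_eq]
      constructor
      · rintro ⟨v, hv, h, rfl⟩; exact ⟨h, hv⟩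
      · rintro ⟨h, hv⟩; exact ⟨_, hv, h, rfl⟩
    rw [this]
    refine ContinuousOn.isOpen_inter_preimage ?_ ?_ hW
    · refine continuousOn_pi.2 fun j ↦ ContinuousOn.div ?_ ?_ fun x hx ↦ hx
      · exact (pp_coord _).continuousOn
      · exact (pp_coord _).continuousOn
    · exact isOpen_ne_fun (pp_coord _) continuous_const

theorem ppChart_image (i : Fin 3) (W : Set (Fin 2 → ℂ)) (x : {v : Fin 3 → ℂ // v ≠ 0}) :
    ppMk x ∈ ppChart i '' W ↔ x.1 i ≠ 0 ∧ (fun j ↦ x.1 (i.succAbove j) / x.1 i) ∈ W := by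
  simp only [Set.mem_image, ppChart_eq_iff]
  constructor
  · rintro ⟨v, hv, h, rfl⟩; exact ⟨h, hv⟩
  · rintro ⟨h, hv⟩; exact ⟨_, hv, h, rfl⟩

theorem pp_good_iff (x : {v : Fin 3 → ℂ // v ≠ 0}) :
    ppMk x ∈ goodLocus ↔ ∀ i j : Fin 3, x.1 i = 0 → x.1 j = 0 → i = j := by
  constructor
  · rintro ⟨y, hy, h⟩ i j hi hj
    obtain ⟨t, ht, e⟩ := ppMk_eq.1 hy
    rw [e] at hi hj
    exact h i j (by simpa [ht] using hi) (by simpa [ht] using hj)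
  · intro h
    exact ⟨x, rfl, h⟩

theorem pp_good_eq : goodLocus = ppChart 0 '' {0}ᶜ ∪ ppChart 1 '' {0}ᶜ := by
  ext p
  obtain ⟨x, rfl⟩ := ppMk_surj p
  have e0 : Fin.succAbove (1 : Fin 3) (0 : Fin 2) = 0 := rfl
  have e1 : Fin.succAbove (1 : Fin 3) (1 : Fin 2) = 2 := rfl
  have e2 : Fin.succAbove (0 : Fin 3) (0 : Fin 2) = 1 := rfl
  have e3 : Fin.succAbove (0 : Fin 3) (1 : Fin 2) = 2 := rfl
  rw [pp_good_iff, Set.mem_union, ppChart_image, ppChart_image]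
  simp only [Set.mem_compl_iff, Set.mem_singleton_iff, funext_iff, Fin.forall_fin_two,
    Pi.zero_apply, div_eq_zero_iff, e0, e1, e2, e3, Fin.forall_fin_succ, Fin.forall_fin_zero]
  have := x.2
  by_cases h0 : x.1 0 = 0 <;> by_cases h1 : x.1 1 = 0 <;> by_cases h2 : x.1 2 = 0 <;>
    simp [h0, h1, h2]

theorem pp_good_sc : IsSimplyConnected goodLocus := by
  rw [pp_good_eq]
  refine pp_vanKampen_set ?_ ?_ ?_ ?_ ?_
  · exact (ppChart_emb 0).isOpenMap _ isOpen_compl_singleton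
  · exact (ppChart_emb 1).isOpenMap _ isOpen_compl_singleton
  · exact (ppChart_emb 0).isEmbedding.isSimplyConnected_image.2 pp_punctured
  · exact (ppChart_emb 1).isEmbedding.isSimplyConnected_image.2 pp_punctured
  · have : ppChart 0 '' {0}ᶜ ∩ ppChart 1 '' {0}ᶜ = ppChart 0 '' {v | v 0 ≠ 0} := by
      ext p
      obtain ⟨x, rfl⟩ := ppMk_surj p
      have e0 : Fin.succAbove (1 : Fin 3) (0 : Fin 2) = 0 := rfl
      have e1 : Fin.succAbove (1 : Fin 3) (1 : Fin 2) = 2 := rfl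
      have e2 : Fin.succAbove (0 : Fin 3) (0 : Fin 2) = 1 := rfl
      have e3 : Fin.succAbove (0 : Fin 3) (1 : Fin 2) = 2 := rfl
      rw [Set.mem_inter_iff, ppChart_image, ppChart_image, ppChart_image]
      simp only [Set.mem_compl_iff, Set.mem_singleton_iff, funext_iff, Fin.forall_fin_two,
        Pi.zero_apply, div_eq_zero_iff, e0, e1, e2, e3, Set.mem_ofPred_eq, ne_eq]
      tauto
    rw [this]
    refine IsPathConnected.image ?_ (ppChart_cont 0)
    have hC : IsPathConnected ({0}ᶜ : Set ℂ) :=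
      isPathConnected_compl_singleton_of_one_lt_rank (by simp) 0
    refine ⟨![1, 0], by simp, fun {v} hv ↦ ?_⟩
    have j := hC.joinedIn 1 (by simp) (v 0) hv
    refine ⟨⟨⟨fun t ↦ ![j.somePath t, t * v 1], ?_⟩, ?_, ?_⟩, fun t ↦ ?_⟩
    · refine continuous_pi fun i ↦ ?_
      fin_cases i <;> simp <;> fun_prop
    · simp
    · ext i; fin_cases i <;> simp
    · have : j.somePath t ≠ 0 := j.somePath_mem t
      exact this

/-- Diagonal scaling on representatives. -/
def ppScale (c : Fin 3 → ℂˣ) (x : {v : Fin 3 → ℂ // v ≠ 0}) : {v : Fin 3 → ℂ // v ≠ 0} :=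
  ⟨fun i ↦ c i * x.1 i, fun h ↦ x.2 (funext fun i ↦ by simpa using congrFun h i)⟩

/-- Diagonal scaling on the projective plane. -/
def ppAct (c : Fin 3 → ℂˣ) : P2 → P2 :=
  Quot.map (ppScale c) (by
    rintro x y ⟨t, ht, h⟩
    exact ⟨t, ht, fun i ↦ by simp only [ppScale, h i]; ring⟩)

theorem ppAct_mk (c : Fin 3 → ℂˣ) (x) : ppAct c (ppMk x) = ppMk (ppScale c x) := rfl

theorem ppAct_cont (c : Fin 3 → ℂˣ) : Continuous (ppAct c) := by
  rw [ppMk_quot.continuous_iff]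
  change Continuous (ppMk ∘ ppScale c)
  refine ppMk_quot.continuous.comp (Continuous.subtype_mk ?_ _)
  exact continuous_pi fun i ↦ continuous_const.mul (pp_coord i)

theorem ppAct_one (p : P2) : ppAct 1 p = p := by
  obtain ⟨x, rfl⟩ := ppMk_surj p
  rw [ppAct_mk]
  congr 1
  ext i; simp [ppScale]

theorem ppAct_mul (c d : Fin 3 → ℂˣ) (p : P2) : ppAct (c * d) p = ppAct c (ppAct d p) := by
  obtain ⟨x, rfl⟩ := ppMk_surj p
  simp only [ppAct_mk]
  congr 1
  ext i; simp [ppScale, mul_assoc]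

theorem ppAct_good (c : Fin 3 → ℂˣ) {p : P2} (hp : p ∈ goodLocus) : ppAct c p ∈ goodLocus := by
  obtain ⟨x, rfl⟩ := ppMk_surj p
  rw [pp_good_iff] at hp
  rw [ppAct_mk, pp_good_iff]
  intro i j hi hj
  exact hp i j (by simpa [ppScale] using hi) (by simpa [ppScale] using hj)

/-- The weights of the action. -/
def ppWt (a : ℤ) (ζ : ℂˣ) : Fin 3 → ℂˣ := ![1, ζ ^ (a + 1), ζ ^ a]

theorem ppWt_one (a : ℤ) : ppWt a 1 = 1 := by
  ext i; fin_cases i <;> simp [ppWt]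

theorem ppWt_mul (a : ℤ) (ζ η : ℂˣ) : ppWt a (ζ * η) = ppWt a ζ * ppWt a η := by
  funext i; fin_cases i <;> simp [ppWt, mul_zpow]

/-- The action of `ℂˣ` on the good locus with weights `(0, a + 1, a)`. -/
@[reducible] def ppMulAction (a : ℤ) : MulAction ℂˣ ↥goodLocus where
  smul ζ u := ⟨ppAct (ppWt a ζ) u, ppAct_good _ u.2⟩
  one_smul u := Subtype.ext (by
    change ppAct (ppWt a 1) u = u
    rw [ppWt_one, ppAct_one])
  mul_smul ζ η u := Subtype.ext (by
    change ppAct (ppWt a (ζ * η)) u = ppAct (ppWt a ζ) (ppAct (ppWt a η) u)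
    rw [ppWt_mul, ppAct_mul])

theorem pp_eq_one {ζ : ℂˣ} {r : ℕ} {b : ℤ} (h : Int.gcd b r = 1) (h1 : ζ ^ r = 1)
    (h2 : ζ ^ b = 1) : ζ = 1 := by
  have e := Int.gcd_eq_gcd_ab b r
  rw [h] at e
  have h1' : ζ ^ (r : ℤ) = 1 := by simpa using h1
  calc ζ = ζ ^ ((1 : ℕ) : ℤ) := by simp
    _ = 1 := by rw [e, zpow_add, zpow_mul, zpow_mul, h1', h2]; simp

theorem pp_free {r : ℕ} {a : ℤ} (ha : Int.gcd a r = 1) (ha1 : Int.gcd (a + 1) r = 1)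
    {ζ : ℂˣ} (hζ : ζ ^ r = 1) {p : P2} (hp : p ∈ goodLocus) (h : ppAct (ppWt a ζ) p = p) :
    ζ = 1 := by
  obtain ⟨x, rfl⟩ := ppMk_surj p
  rw [pp_good_iff] at hp
  rw [ppAct_mk] at h
  obtain ⟨t, ht, e⟩ := ppMk_eq.1 h.symm
  have e0 : x.1 0 = t * x.1 0 := by simpa [ppScale, ppWt] using e 0
  have e1 : ((ζ ^ (a + 1) : ℂˣ) : ℂ) * x.1 1 = t * x.1 1 := e 1
  have e2 : ((ζ ^ a : ℂˣ) : ℂ) * x.1 2 = t * x.1 2 := e 2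
  by_cases h0 : x.1 0 = 0
  · have h1 : x.1 1 ≠ 0 := fun h ↦ by simpa using hp 0 1 h0 h
    have h2 : x.1 2 ≠ 0 := fun h ↦ by simpa using hp 0 2 h0 h
    have f1 := mul_right_cancel₀ h1 e1
    have f2 := mul_right_cancel₀ h2 e2
    have f3 : ζ ^ (a + 1) = ζ ^ a := Units.ext (f1.trans f2.symm)
    rw [zpow_add, zpow_one] at f3
    simpa using f3
  · have t1 : t = 1 := (mul_right_cancel₀ h0 ((one_mul _).trans e0)).symm
    rw [t1] at e1 e2
    by_cases h1 : x.1 1 = 0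
    · have h2 : x.1 2 ≠ 0 := fun h ↦ by simpa using hp 1 2 h1 h
      exact pp_eq_one ha hζ (Units.ext (mul_right_cancel₀ h2 e2))
    · exact pp_eq_one ha1 hζ (Units.ext (mul_right_cancel₀ h1 e1))

/-- A finite group acting freely on a Hausdorff space has neighborhoods with disjoint translates. -/
theorem pp_disjoint {E G : Type*} [TopologicalSpace E] [T2Space E] [Group G] [Finite G]
    [MulAction G E] (hc : ∀ g : G, Continuous fun e : E ↦ g • e)
    (hf : ∀ (g : G) (e : E), g • e = e → g = 1) (e : E) :
    ∃ U ∈ 𝓝 e, ∀ g : G, ((g • ·) '' U ∩ U).Nonempty → g = 1 := by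
  have h (g : G) : ∃ W ∈ 𝓝 e, ((g • ·) '' W ∩ W).Nonempty → g = 1 := by
    by_cases hg : g = 1
    · exact ⟨Set.univ, Filter.univ_mem, fun _ ↦ hg⟩
    · obtain ⟨u, v, hu, hv, d⟩ := t2_separation_nhds (fun h ↦ hg (hf g e h))
      refine ⟨(g • ·) ⁻¹' u ∩ v, Filter.inter_mem ((hc g).continuousAt hu) hv, ?_⟩
      rintro ⟨_, ⟨y, hy, rfl⟩, hz⟩
      exact absurd hz.2 (Set.disjoint_left.1 d hy.1)
  choose W hW hW' using h
  refine ⟨⋂ g, W g, Filter.iInter_mem.2 hW, ?_⟩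
  rintro g ⟨_, ⟨y, hy, rfl⟩, hz⟩
  exact hW' g ⟨_, ⟨y, Set.mem_iInter.1 hy g, rfl⟩, Set.mem_iInter.1 hz g⟩

end Helpers

/-- With `gcd(a, r) = gcd(a+1, r) = 1`, `ε` a primitive `r`-th root of
unity and `g[x₀:x₁:x₂] = [x₀ : ε^{a+1} x₁ : ε^a x₂]`, the fundamental group of the
quotient `U/⟨g⟩` of the locus `U` of points with at most one zero coordinate is
isomorphic to `ℤ/rℤ` at every basepoint. -/
theorem pi1_of_quotient_by_diag_action
    (r : ℕ) (hr : 1 ≤ r) (a : ℤ) (ha : Int.gcd a r = 1) (ha1 : Int.gcd (a + 1) r = 1)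
    (ε : ℂ) (hε : IsPrimitiveRoot ε r)
    (g : P2 → P2)
    (hg : ∀ x y : {v : Fin 3 → ℂ // v ≠ 0},
      (∀ i, (y : Fin 3 → ℂ) i = ![(1 : ℂ), ε ^ (a + 1), ε ^ a] i * (x : Fin 3 → ℂ) i) →
      g (Quot.mk projRel3 x) = Quot.mk projRel3 y) :
    ∀ z : Quot (cyclicOrbitRel g),
      Nonempty (FundamentalGroup (Quot (cyclicOrbitRel g)) z ≃* Multiplicative (ZMod r)) := by
  intro z
  obtain ⟨η, rfl⟩ : ∃ η : ℂˣ, (η : ℂ) = ε := hε.isUnit (by omega)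
  have hη : IsPrimitiveRoot η r := IsPrimitiveRoot.coe_units_iff.1 hε
  have hgact : ∀ p, g p = ppAct (ppWt a η) p := by
    intro p
    obtain ⟨x, rfl⟩ := ppMk_surj p
    refine hg x _ fun i ↦ ?_
    fin_cases i <;> simp [ppScale, ppWt]
  let _ := ppMulAction a
  have hiter (k : ℕ) (u : ↥goodLocus) : g^[k] (u : P2) = ((η ^ k • u : ↥goodLocus) : P2) := by
    induction k with
    | zero => simp
    | succ k ih =>
      rw [Function.iterate_succ_apply', ih, hgact, pow_succ', mul_smul]
      rfl
  let G := Subgroup.zpowers η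
  have hfin : IsOfFinOrder η := isOfFinOrder_iff_pow_eq_one.2 ⟨r, by omega, hη.pow_eq_one⟩
  haveI : Finite G := hfin.finite_zpowers
  have hGr (ζ : G) : (ζ : ℂˣ) ^ r = 1 := by
    obtain ⟨_, k, rfl⟩ := ζ
    change (η ^ k) ^ r = 1
    rw [← zpow_natCast, ← zpow_mul, mul_comm, zpow_mul, zpow_natCast, hη.pow_eq_one, one_zpow]
  have hcont : ∀ ζ : G, Continuous fun u : ↥goodLocus ↦ ζ • u := fun ζ ↦
    Continuous.subtype_mk ((ppAct_cont _).comp continuous_subtype_val) _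
  have hrel (u v : ↥goodLocus) : cyclicOrbitRel g u v ↔ MulAction.orbitRel G ↥goodLocus v u := by
    rw [MulAction.orbitRel_apply]
    constructor
    · rintro ⟨k, hk⟩
      rw [hiter] at hk
      exact ⟨⟨η ^ k, k, by simp⟩, Subtype.ext hk⟩
    · rintro ⟨⟨ζ, hζ⟩, h⟩
      obtain ⟨k, rfl⟩ := (hfin.mem_powers_iff_mem_zpowers).2 hζ
      exact ⟨k, by rw [hiter]; exact congrArg Subtype.val h⟩
  have hquot : IsQuotientCoveringMap (Quot.mk (cyclicOrbitRel g)) G :=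
    { toIsQuotientMap := isQuotientMap_quot_mk
      continuous_const_smul := hcont
      apply_eq_iff_mem_orbit := by
        intro u v
        have heq : Equivalence (cyclicOrbitRel g) :=
          { refl := fun u ↦ (hrel _ _).2 (Setoid.refl' _ u)
            symm := fun h ↦ (hrel _ _).2 (Setoid.symm' _ ((hrel _ _).1 h))
            trans := fun h h' ↦
              (hrel _ _).2 (Setoid.trans' _ ((hrel _ _).1 h') ((hrel _ _).1 h)) }
        rw [Quot.eq, heq.eqvGen_iff, hrel, ← MulAction.orbitRel_apply]
        exact ⟨fun h ↦ Setoid.symm' _ h, fun h ↦ Setoid.symm' _ h⟩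
      disjoint := pp_disjoint hcont fun ζ u h ↦
        Subtype.ext (pp_free ha ha1 (hGr ζ) u.2 (congrArg Subtype.val h)) }
  haveI : SimplyConnectedSpace ↥goodLocus := pp_good_sc
  obtain ⟨u, hu⟩ := Quot.exists_rep z
  exact ⟨(hquot.fundamentalGroupEquiv ⟨u, hu⟩).trans
    ((MulOpposite.opMulEquiv.symm).trans
      hη.zmodEquivZPowers.symm.toMultiplicativeRight)⟩
end
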